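/- arXiv:1312.1636 — 7 statements merged into one kernel-verified Lean document; each statement's English description precedes it below -/
import Mathlib

section
/- Let 0 < α < 1, 0 < β < 1, 0 < γ < 1 with β ≠ γ. For every k ≥ 2, the equation b_k(t) = x_{k−1}(t) in the unknown t ∈ ℝ has the unique solution t = t_{k−1} := ((1−β)/(1−αβ)) · ((1−αγ)/(1−γ)) · (β/γ)^{k−1}; in particular b_k(t_{k−1}) = x_{k−1}(t_{k−1}). -/
/-- The barycenter at time `t` of the particles with masses `α^j` located at
`β^j + t(1-γ^j)`, for indices `j ≥ k`. -/
noncomputable def barycenter (α β γ : ℝ) (k : ℕ) (t : ℝ) : ℝ :=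
  (∑' j : {j : ℕ // k ≤ j}, α ^ (j : ℕ) * (β ^ (j : ℕ) + t * (1 - γ ^ (j : ℕ)))) /
    (∑' j : {j : ℕ // k ≤ j}, α ^ (j : ℕ))

/-- The free trajectory of the `k`-th particle. -/
def freeTraj (β γ : ℝ) (k : ℕ) (t : ℝ) : ℝ := β ^ k + t * (1 - γ ^ k)

theorem hasSum_geom_tail (r : ℝ) (h0 : 0 < r) (h1 : r < 1) (k : ℕ) :
    HasSum (fun j : {j : ℕ // k ≤ j} => r ^ (j : ℕ)) (r ^ k / (1 - r)) := by
  let e : ℕ ≃ {j : ℕ // k ≤ j} :=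
    { toFun := fun n => ⟨n + k, Nat.le_add_left k n⟩
      invFun := fun j => j.1 - k
      left_inv := fun n => by simp
      right_inv := fun j => Subtype.ext (Nat.sub_add_cancel j.2) }
  rw [← e.hasSum_iff]
  have h := (hasSum_geometric_of_lt_one h0.le h1).mul_left (r ^ k)
  rw [← div_eq_mul_inv] at h
  have h6 : ((fun j : {j : ℕ // k ≤ j} => r ^ (j : ℕ)) ∘ e) = fun n => r ^ k * r ^ n := by
    funext n
    simp only [Function.comp, e, Equiv.coe_fn_mk]
    rw [pow_add, mul_comm]
  rw [h6]
  exact h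

theorem barycenter_eq (α β γ : ℝ) (hα : 0 < α) (hα1 : α < 1)
    (hβ : 0 < β) (hβ1 : β < 1) (hγ : 0 < γ) (hγ1 : γ < 1) (k : ℕ) (t : ℝ) :
    barycenter α β γ k t =
      β ^ k * ((1 - α) / (1 - α * β)) + t * (1 - γ ^ k * ((1 - α) / (1 - α * γ))) := by
  have hab : α * β < 1 := by nlinarith
  have hag : α * γ < 1 := by nlinarith
  have h1 := hasSum_geom_tail α hα hα1 k
  have h2 := hasSum_geom_tail (α * β) (by positivity) hab k
  have h3 := hasSum_geom_tail (α * γ) (by positivity) hag k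
  have h4 := h2.add ((h1.sub h3).mul_left t)
  have h5 : (fun j : {j : ℕ // k ≤ j} =>
      α ^ (j : ℕ) * (β ^ (j : ℕ) + t * (1 - γ ^ (j : ℕ)))) =
      fun j : {j : ℕ // k ≤ j} => (α * β) ^ (j : ℕ) +
        t * (α ^ (j : ℕ) - (α * γ) ^ (j : ℕ)) := by
    funext j
    rw [mul_pow, mul_pow]
    ring
  unfold barycenter
  rw [h5, h4.tsum_eq, h1.tsum_eq, mul_pow, mul_pow]
  have : 1 - α ≠ 0 := by linarith
  have : 1 - α * β ≠ 0 := by linarith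
  have : 1 - α * γ ≠ 0 := by linarith
  have : α ^ k ≠ 0 := by positivity
  field_simp

/-- The equation `b_k(t) = x_{k-1}(t)` has the unique solution
`t = t_{k-1} = ((1-β)/(1-αβ))·((1-αγ)/(1-γ))·(β/γ)^(k-1)`. -/
theorem collision_time_unique (α β γ : ℝ) (hα : 0 < α) (hα1 : α < 1)
    (hβ : 0 < β) (hβ1 : β < 1) (hγ : 0 < γ) (hγ1 : γ < 1) (hβγ : β ≠ γ)
    (k : ℕ) (hk : 2 ≤ k) :
    (∀ t : ℝ, barycenter α β γ k t = freeTraj β γ (k - 1) t ↔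
      t = ((1 - β) / (1 - α * β)) * ((1 - α * γ) / (1 - γ)) * (β / γ) ^ (k - 1)) ∧
    barycenter α β γ k
        (((1 - β) / (1 - α * β)) * ((1 - α * γ) / (1 - γ)) * (β / γ) ^ (k - 1)) =
      freeTraj β γ (k - 1)
        (((1 - β) / (1 - α * β)) * ((1 - α * γ) / (1 - γ)) * (β / γ) ^ (k - 1)) := by
  have key : ∀ t : ℝ, barycenter α β γ k t = freeTraj β γ (k - 1) t ↔
      t = ((1 - β) / (1 - α * β)) * ((1 - α * γ) / (1 - γ)) * (β / γ) ^ (k - 1) := by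
    intro t
    obtain ⟨m, rfl⟩ : ∃ m, k = m + 1 := ⟨k - 1, by omega⟩
    rw [barycenter_eq α β γ hα hα1 hβ hβ1 hγ hγ1]
    simp only [freeTraj, Nat.add_sub_cancel, pow_succ, div_pow]
    have hab : 1 - α * β ≠ 0 := by nlinarith
    have hag : 1 - α * γ ≠ 0 := by nlinarith
    have hg : 1 - γ ≠ 0 := by linarith
    have hgm : γ ^ m ≠ 0 := by positivity
    have e1 : β * ((1 - α) / (1 - α * β)) = 1 - (1 - β) / (1 - α * β) := by
      rw [eq_sub_iff_add_eq, mul_div_assoc', ← add_div, div_eq_one_iff_eq hab]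
      ring
    have e2 : γ * ((1 - α) / (1 - α * γ)) = 1 - (1 - γ) / (1 - α * γ) := by
      rw [eq_sub_iff_add_eq, mul_div_assoc', ← add_div, div_eq_one_iff_eq hag]
      ring
    rw [mul_assoc, e1, mul_assoc, e2]
    have e3 : (1 - β) / (1 - α * β) * ((1 - α * γ) / (1 - γ)) * (β ^ m / γ ^ m) =
        ((1 - β) / (1 - α * β) * β ^ m) / ((1 - γ) / (1 - α * γ) * γ ^ m) := by
      field_simp
    rw [e3, eq_div_iff (mul_ne_zero (div_ne_zero hg hag) hgm)]
    constructor <;> intro h <;> linarith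
  exact ⟨key, (key _).2 rfl⟩
end

section
/- (Lemma 1) Let 0 < β < γ < 1 and 0 < α < 1/(1+β+γ). Then for every k > 1 one has x_{k+1}(t_{k−1}) > x_{k−1}(t_{k−1}) = b_k(t_{k−1}), where x_j(t) = β^j + t(1−γ^j), b_k(t) = (Σ_{j≥k} α^j (β^j + t(1−γ^j))) / (Σ_{j≥k} α^j), and t_{k−1} = ((1−β)/(1−αβ)) · ((1−αγ)/(1−γ)) · (β/γ)^{k−1}. -/
/-- The collision time `t_k`. -/
noncomputable def collisionTime (α β γ : ℝ) (k : ℕ) : ℝ :=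
  ((1 - β) / (1 - α * β)) * ((1 - α * γ) / (1 - γ)) * (β / γ) ^ k

theorem geo_tail (r : ℝ) (h0 : 0 ≤ r) (h1 : r < 1) (k : ℕ) :
    HasSum (fun j : {j : ℕ // k ≤ j} => r ^ (j : ℕ)) (r ^ k / (1 - r)) := by
  let e : ℕ ≃ {j : ℕ // k ≤ j} :=
    { toFun := fun n => ⟨n + k, by omega⟩
      invFun := fun j => j.1 - k
      left_inv := fun n => by simp
      right_inv := fun j => by
        apply Subtype.ext
        have := j.2
        simp only
        omega }
  rw [← e.hasSum_iff]
  have h := (hasSum_geometric_of_lt_one h0 h1).mul_left (r ^ k)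
  rw [← div_eq_mul_inv] at h
  refine h.congr_fun (fun n => ?_)
  simp only [Function.comp, e, Equiv.coe_fn_mk, pow_add]
  ring

/-- Lemma 1: if `0 < β < γ < 1` and `0 < α < 1/(1+β+γ)`, then for every `k > 1`,
`x_{k+1}(t_{k-1}) > x_{k-1}(t_{k-1}) = b_k(t_{k-1})`. -/
theorem lemma1 (α β γ : ℝ) (hβ : 0 < β) (hβγ : β < γ) (hγ1 : γ < 1)
    (hα : 0 < α) (hα1 : α < 1 / (1 + β + γ)) (k : ℕ) (hk : 1 < k) :
    freeTraj β γ (k + 1) (collisionTime α β γ (k - 1)) >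
      freeTraj β γ (k - 1) (collisionTime α β γ (k - 1)) ∧
    freeTraj β γ (k - 1) (collisionTime α β γ (k - 1)) =
      barycenter α β γ k (collisionTime α β γ (k - 1)) := by
  obtain ⟨n, rfl⟩ : ∃ n, k = n + 1 := ⟨k - 1, by omega⟩
  have hγ : 0 < γ := hβ.trans hβγ
  have hs : α * (1 + β + γ) < 1 := by
    rwa [lt_div_iff₀ (by positivity)] at hα1
  have hab : 0 < α * β := by positivity
  have hag : 0 < α * γ := by positivity
  have ha1 : 0 < 1 - α := by nlinarith
  have hb1 : 0 < 1 - α * β := by nlinarith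
  have hg1 : 0 < 1 - α * γ := by nlinarith
  have hg : 0 < 1 - γ := by linarith
  have hn : n + 1 - 1 = n := by omega
  rw [hn]
  have hB : 0 < β ^ n := by positivity
  have hG : 0 < γ ^ n := by positivity
  have ht : collisionTime α β γ n * γ ^ n * ((1 - α * β) * (1 - γ))
      = β ^ n * ((1 - β) * (1 - α * γ)) := by
    unfold collisionTime
    rw [div_pow]
    have hb1' : 1 - β * α ≠ 0 := by rw [mul_comm]; exact hb1.ne'
    have hg1' : 1 - γ * α ≠ 0 := by rw [mul_comm]; exact hg1.ne'
    field_simp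
  generalize collisionTime α β γ n = t at ht
  constructor
  · unfold freeTraj
    have key : 0 < (t * γ ^ n * (1 - γ ^ 2) - β ^ n * (1 - β ^ 2)) * (1 - α * β) := by
      have e : (t * γ ^ n * (1 - γ ^ 2) - β ^ n * (1 - β ^ 2)) * (1 - α * β)
          = β ^ n * ((1 - β) * ((γ - β) * (1 - α * (1 + β + γ)))) := by
        linear_combination (1 + γ) * ht
      rw [e]
      have h1 : 0 < 1 - β := by linarith
      have h2 : 0 < γ - β := by linarith
      have h3 : 0 < 1 - α * (1 + β + γ) := by linarith
      positivity
    have key2 := pos_of_mul_pos_left key hb1.le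
    simp only [pow_succ] at key2 ⊢
    nlinarith
  · have S1 := geo_tail α hα.le (by linarith) (n + 1)
    have S2 := geo_tail (α * β) hab.le (by linarith) (n + 1)
    have S3 := geo_tail (α * γ) hag.le (by linarith) (n + 1)
    have S : HasSum (fun j : {j : ℕ // n + 1 ≤ j} =>
        α ^ (j : ℕ) * (β ^ (j : ℕ) + t * (1 - γ ^ (j : ℕ)))) _ :=
      (S2.add ((S1.sub S3).mul_left t)).congr_fun (fun j => by
        rw [mul_pow, mul_pow]; ring)
    unfold barycenter freeTraj
    rw [S.tsum_eq, S1.tsum_eq]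
    have hA : 0 < α ^ n := by positivity
    rw [eq_div_iff (by positivity)]
    simp only [mul_pow, pow_succ]
    field_simp
    linear_combination (-1 : ℝ) * ht
end

section
/- (Lemma 2) Let 0 < β < γ < 1 and 0 < α < 1/(1+β+γ). Then for every k > 1 there exists a time τ_k ∈ (t_k, t_{k−1}) with the following property: for every subset S′ of S_k := {j ∈ ℕ : j ≥ k} with k ∈ S′ and S′ ≠ S_k, the partial barycenter satisfies (Σ_{j∈S′} α^j x_j(τ_k)) / (Σ_{j∈S′} α^j) < (Σ_{j∈S_k} α^j x_j(τ_k)) / (Σ_{j∈S_k} α^j) = b_k(τ_k), where x_j(t) = β^j + t(1−γ^j). (For infinite S′ the sums are convergent series since 0 < α < 1.) -/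
/-- The barycenter at time `t` of the particles with masses `α^j` located at
`x_j(t) = β^j + t(1-γ^j)`, for indices `j` in a set `S ⊆ ℕ`. -/
noncomputable def setBarycenter (α β γ : ℝ) (S : Set ℕ) (t : ℝ) : ℝ :=
  (∑' j : S, α ^ (j : ℕ) * freeTraj β γ (j : ℕ) t) / (∑' j : S, α ^ (j : ℕ))

theorem hasSum_tail (a : ℝ) (h0 : 0 < a) (h1 : a < 1) (k : ℕ) :
    HasSum (fun j : {j : ℕ | k ≤ j} => a ^ (j : ℕ)) (a ^ k / (1 - a)) := by
  have h := (hasSum_geometric_of_lt_one h0.le h1).mul_left (a ^ k)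
  have hr : {j : ℕ | k ≤ j} = Set.range (fun n : ℕ => n + k) := by
    ext j
    simp only [Set.mem_ofPred_eq, Set.mem_range]
    exact ⟨fun hj => ⟨j - k, by omega⟩, fun ⟨n, hn⟩ => by omega⟩
  rw [hr]
  have hinj : Function.Injective (fun n : ℕ => n + k) := fun a b hab => by simpa using hab
  refine (hinj.hasSum_range_iff (f := fun j : ℕ => a ^ j)).2 ?_
  rw [div_eq_mul_inv]
  have e : ((fun j : ℕ => a ^ j) ∘ fun n : ℕ => n + k) = fun i => a ^ k * a ^ i := by
    funext n
    simp [pow_add, mul_comm]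
  rw [e]
  exact h

theorem core_bary (m x : ℕ → ℝ) (hm : Summable m) (hx : Summable fun j => m j * x j)
    (hpos : ∀ j, 0 < m j) (S S' : Set ℕ) (hS : S' ⊆ S) (k : ℕ) (hk : k ∈ S') (hne : S' ≠ S)
    (M N : ℝ) (hM : HasSum (fun j : S => m j) M) (hN : HasSum (fun j : S => m j * x j) N)
    (hB : ∀ j ∈ S, j ∉ S' → N < x j * M) :
    (∑' j : S', m j * x j) / (∑' j : S', m j) < (∑' j : S, m j * x j) / (∑' j : S, m j) := by
  obtain ⟨c, hcS, hcS'⟩ : ∃ c ∈ S, c ∉ S' := by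
    by_contra! h
    exact hne (hS.antisymm h)
  have hu : S = S' ∪ (S \ S') := (Set.union_sdiff_cancel hS).symm
  have hd : Disjoint S' (S \ S') := Set.disjoint_sdiff_right
  have e1 := Summable.tsum_union_disjoint (f := m) hd (hm.subtype _) (hm.subtype _)
  have e2 := Summable.tsum_union_disjoint (f := fun j => m j * x j) hd (hx.subtype _) (hx.subtype _)
  rw [← hu] at e1 e2
  rw [hM.tsum_eq] at e1
  rw [hN.tsum_eq] at e2
  have p1 : 0 < ∑' j : S', m j :=
    (hm.subtype S').tsum_pos (fun j => (hpos j.1).le) ⟨k, hk⟩ (hpos k)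
  have p2 : 0 < ∑' j : (S \ S' : Set ℕ), m j :=
    (hm.subtype (S \ S')).tsum_pos (fun j => (hpos j.1).le) ⟨c, hcS, hcS'⟩ (hpos c)
  have p3 : ∑' j : (S \ S' : Set ℕ), N * m j < ∑' j : (S \ S' : Set ℕ), M * (m j * x j) := by
    have key : ∀ j : (S \ S' : Set ℕ), N * m j < M * (m j * x j) := fun j => by
      have := mul_lt_mul_of_pos_left (hB j j.2.1 j.2.2) (hpos j)
      linarith
    exact Summable.tsum_lt_tsum (fun j => (key j).le) (key ⟨c, hcS, hcS'⟩)
      ((hm.subtype (S \ S')).mul_left N) ((hx.subtype (S \ S')).mul_left M)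
  rw [tsum_mul_left, tsum_mul_left] at p3
  rw [hM.tsum_eq, hN.tsum_eq, div_lt_div_iff₀ p1 (by linarith)]
  generalize (∑' j : S', m j) = a at *
  generalize (∑' j : S', m j * x j) = b at *
  generalize (∑' j : (S \ S' : Set ℕ), m j) = a' at *
  generalize (∑' j : (S \ S' : Set ℕ), m j * x j) = b' at *
  have h1 : b = N - b' := by linarith
  have h2 : a = M - a' := by linarith
  rw [h1, h2]
  linarith

/-- Lemma 2: for every `k > 1` there is a time `τ_k ∈ (t_k, t_{k-1})` such that, for every
proper subset `S' ⊊ S_k = {j : j ≥ k}` containing `k`, the barycenter of the particles with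
indices in `S'` lies strictly to the left of the barycenter `b_k(τ_k)` of all particles with
indices in `S_k`. -/
theorem lemma2 (α β γ : ℝ) (hβ : 0 < β) (hβγ : β < γ) (hγ1 : γ < 1)
    (hα : 0 < α) (hα1 : α < 1 / (1 + β + γ)) (k : ℕ) (hk : 1 < k) :
    ∃ τ : ℝ, collisionTime α β γ k < τ ∧ τ < collisionTime α β γ (k - 1) ∧
      ∀ S' : Set ℕ, S' ⊆ {j : ℕ | k ≤ j} → k ∈ S' → S' ≠ {j : ℕ | k ≤ j} →
        setBarycenter α β γ S' τ < setBarycenter α β γ {j : ℕ | k ≤ j} τ := by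
  obtain ⟨m, rfl⟩ : ∃ m, k = m + 1 := ⟨k - 1, by omega⟩
  have hγ : 0 < γ := hβ.trans hβγ
  have hs : α * (1 + β + γ) < 1 := by rwa [lt_div_iff₀ (by positivity)] at hα1
  obtain ⟨r, hr⟩ : ∃ r, r = β / γ := ⟨_, rfl⟩
  have hr0 : 0 < r := hr ▸ div_pos hβ hγ
  have hr1 : r < 1 := hr ▸ (div_lt_one hγ).2 hβγ
  have hβr : β = r * γ := by rw [hr]; field_simp
  have hαβ : 0 < α * β := by positivity
  have hαγ : 0 < α * γ := by positivity
  have hα2 : α < 1 := by nlinarith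
  have hαβ1 : 0 < 1 - α * β := by nlinarith
  have hαγ1 : 0 < 1 - α * γ := by nlinarith
  have hA : 0 < 1 - α - α * β := by nlinarith
  have hD : 0 < 1 - α - α * γ := by nlinarith
  have hAD : 1 - α - α * γ < 1 - α - α * β := by nlinarith
  have b1 : r * (1 - α - α * β) / (1 - α - α * γ) < 1 := by
    rw [div_lt_one hD]
    have : 0 < (1 - r) * (1 - α * (1 + β + γ)) := mul_pos (by linarith) (by linarith)
    subst hβr
    nlinarith
  have b2 : r ^ 2 * (1 - α * β) / (1 - α * γ) < 1 := by
    rw [div_lt_one hαγ1]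
    have h1 : 0 < (1 - r) * (1 + r) * (1 - α * (1 + β + γ)) :=
      mul_pos (mul_pos (by linarith) (by linarith)) (by linarith)
    have h2 : 0 < (1 - r) * (1 + r) * α := by
      have : 0 < 1 - r := by linarith
      positivity
    have h3 : 0 < (1 - r) * α * γ * r := by
      have : 0 < 1 - r := by linarith
      positivity
    subst hβr
    nlinarith
  obtain ⟨s, hs1, hs2⟩ := exists_between (max_lt b1 b2)
  obtain ⟨c1, c2⟩ := max_lt_iff.1 hs1
  rw [div_lt_iff₀ hD] at c1
  rw [div_lt_iff₀ hαγ1] at c2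
  have hrs : r < s := by
    by_contra! h
    have := mul_le_mul_of_nonneg_right h hD.le
    have := mul_lt_mul_of_pos_left hAD hr0
    linarith
  have n1 : 1 - β * α ≠ 0 := by rw [mul_comm]; exact hαβ1.ne'
  have n2 : 1 - α * β ≠ 0 := hαβ1.ne'
  have n3 : 1 - γ * α ≠ 0 := by rw [mul_comm]; exact hαγ1.ne'
  have n4 : 1 - α * γ ≠ 0 := hαγ1.ne'
  have hγ' : 0 < 1 - γ := by linarith
  have hβ' : 0 < 1 - β := by linarith
  obtain ⟨t, ht⟩ : ∃ t, t = ((1 - β) / (1 - α * β)) * ((1 - α * γ) / (1 - γ)) * r ^ m := ⟨_, rfl⟩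
  have ht0 : 0 < t := by rw [ht]; positivity
  have hteq : t * (1 - γ) * (1 - α * β) = (1 - β) * (1 - α * γ) * r ^ m := by
    rw [ht]; field_simp
  have hR : 0 < r ^ m := by positivity
  refine ⟨t * s, ?_, ?_, ?_⟩
  · have : collisionTime α β γ (m + 1) = t * r := by
      rw [collisionTime, ht, ← hr]; ring
    rw [this]
    exact mul_lt_mul_of_pos_left hrs ht0
  · have : collisionTime α β γ (m + 1 - 1) = t := by
      rw [collisionTime, ht, ← hr]; simp
    rw [this]
    nlinarith
  intro S' hS hkS hne
  have hterm : ∀ j : ℕ, α ^ j * freeTraj β γ j (t * s)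
      = (α * β) ^ j + t * s * α ^ j - t * s * (α * γ) ^ j := fun j => by
    rw [freeTraj, mul_pow, mul_pow]; ring
  have g1 := summable_geometric_of_lt_one hα.le hα2
  have g2 := summable_geometric_of_lt_one hαβ.le (by linarith : α * β < 1)
  have g3 := summable_geometric_of_lt_one hαγ.le (by linarith : α * γ < 1)
  have k1 := hasSum_tail α hα hα2 (m + 1)
  have k2 := hasSum_tail (α * β) hαβ (by linarith) (m + 1)
  have k3 := hasSum_tail (α * γ) hαγ (by linarith) (m + 1)
  have hτ1 : r ^ m * r ^ 2 * (1 - β) < t * s * (1 - γ) := by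
    have e : t * s * (1 - γ) * (1 - α * β) = (1 - β) * r ^ m * (s * (1 - α * γ)) := by
      linear_combination s * hteq
    refine lt_of_mul_lt_mul_right ?_ hαβ1.le
    rw [e]
    have := mul_lt_mul_of_pos_left c2 (mul_pos hβ' hR)
    linarith
  have hmono : ∀ n : ℕ, freeTraj β γ (m + 2) (t * s) ≤ freeTraj β γ (m + 2 + n) (t * s) := by
    intro n
    induction n with
    | zero => simp
    | succ n ih =>
      refine ih.trans ?_
      have hp : r ^ n ≤ 1 := pow_le_one₀ hr0.le hr1.le
      have e : freeTraj β γ (m + 2 + (n + 1)) (t * s) - freeTraj β γ (m + 2 + n) (t * s)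
          = γ ^ (m + 2 + n) * (t * s * (1 - γ) - r ^ m * r ^ 2 * (1 - β) * r ^ n) := by
        have : β ^ (m + 2 + n) = r ^ m * r ^ 2 * r ^ n * γ ^ (m + 2 + n) := by
          rw [← pow_add, ← pow_add, ← mul_pow, ← hβr]
        rw [freeTraj, freeTraj, ← add_assoc, pow_succ β, pow_succ γ, this]
        ring
      have : 0 ≤ γ ^ (m + 2 + n) * (t * s * (1 - γ) - r ^ m * r ^ 2 * (1 - β) * r ^ n) := by
        refine mul_nonneg (by positivity) ?_
        have : r ^ m * r ^ 2 * (1 - β) * r ^ n ≤ r ^ m * r ^ 2 * (1 - β) * 1 :=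
          mul_le_mul_of_nonneg_left hp (by positivity)
        linarith
      linarith
  have hα' : 0 < 1 - α := by linarith
  have hmain : (α * β) ^ (m + 1) / (1 - α * β) + t * s * (α ^ (m + 1) / (1 - α))
      - t * s * ((α * γ) ^ (m + 1) / (1 - α * γ))
      < freeTraj β γ (m + 2) (t * s) * (α ^ (m + 1) / (1 - α)) := by
    have hb : β ^ (m + 1) = r ^ m * r * γ ^ (m + 1) := by
      rw [← pow_succ, ← mul_pow, ← hβr]
    have ht2 : t = (1 - β) * (1 - α * γ) * r ^ m / ((1 - γ) * (1 - α * β)) := by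
      rw [eq_div_iff (by positivity)]; linarith
    have e : freeTraj β γ (m + 2) (t * s) * (α ^ (m + 1) / (1 - α))
       - ((α * β) ^ (m + 1) / (1 - α * β) + t * s * (α ^ (m + 1) / (1 - α))
      - t * s * ((α * γ) ^ (m + 1) / (1 - α * γ)))
      = α ^ (m + 1) * γ ^ (m + 1) * r ^ m * (1 - β) / ((1 - α) * (1 - α * β))
        * (s * (1 - α - α * γ) - r * (1 - α - α * β)) := by
      rw [freeTraj, mul_pow, mul_pow, show m + 2 = (m + 1) + 1 from rfl, pow_succ β (m + 1),
        pow_succ γ (m + 1), hb, ht2]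
      generalize γ ^ (m + 1) = G
      generalize α ^ (m + 1) = F
      generalize r ^ m = R
      field_simp
      ring
    have : 0 < α ^ (m + 1) * γ ^ (m + 1) * r ^ m * (1 - β) / ((1 - α) * (1 - α * β))
        * (s * (1 - α - α * γ) - r * (1 - α - α * β)) :=
      mul_pos (by positivity) (by linarith)
    linarith
  refine core_bary (fun j => α ^ j) (fun j => freeTraj β γ j (t * s)) g1 ?_
    (fun j => by positivity) _ S' hS (m + 1) hkS hne _
    ((α * β) ^ (m + 1) / (1 - α * β) + t * s * (α ^ (m + 1) / (1 - α))
      - t * s * ((α * γ) ^ (m + 1) / (1 - α * γ))) k1 ?_ ?_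
  · simp only [hterm]
    exact (g2.add (g1.mul_left _)).sub (g3.mul_left _)
  · simp only [hterm]
    exact (k2.add (k1.mul_left _)).sub (k3.mul_left _)
  · intro j hj hj'
    have hj1 : m + 1 ≤ j := hj
    have hj2 : j ≠ m + 1 := fun h => hj' (h ▸ hkS)
    obtain ⟨n, rfl⟩ : ∃ n, j = m + 2 + n := ⟨j - (m + 2), by omega⟩
    exact hmain.trans_le (mul_le_mul_of_nonneg_right (hmono n) (by positivity))
end

section
/- Let 0 < β < γ < 1 and 0 < α < 1/(1+β+γ). Then for every k > 1 there exists τ_k with t_k < τ_k < t_{k−1} such that x_{k+1}(τ_k) > b_k(τ_k), where x_j(t) = β^j + t(1−γ^j) and b_k(t) = (Σ_{j≥k} α^j (β^j + t(1−γ^j))) / (Σ_{j≥k} α^j). -/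
def shiftEquivAux (k : ℕ) : ℕ ≃ {j : ℕ // k ≤ j} where
  toFun i := ⟨i + k, Nat.le_add_left k i⟩
  invFun j := j.1 - k
  left_inv i := by simp
  right_inv j := by
    ext
    simp [Nat.sub_add_cancel j.2]

lemma hasSum_geom_aux (q : ℝ) (h0 : 0 ≤ q) (h1 : q < 1) (k : ℕ) :
    HasSum (fun j : {j : ℕ // k ≤ j} => q ^ (j : ℕ)) (q ^ k * (1 - q)⁻¹) := by
  rw [← (shiftEquivAux k).hasSum_iff]
  have h := (hasSum_geometric_of_lt_one h0 h1).mul_left (q ^ k)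
  refine h.congr_fun ?_
  intro i
  simp [shiftEquivAux, pow_add, mul_comm]

lemma barycenter_eq_aux (α β γ : ℝ) (hα : 0 < α) (hα1 : α < 1) (hβ : 0 < β) (hβ1 : β < 1)
    (hγ : 0 < γ) (hγ1 : γ < 1) (k : ℕ) (t : ℝ) :
    barycenter α β γ k t =
      (1 - α) / (1 - α * β) * β ^ k + t * (1 - (1 - α) / (1 - α * γ) * γ ^ k) := by
  have hab : α * β < 1 := by nlinarith
  have hag : α * γ < 1 := by nlinarith
  have h1 := hasSum_geom_aux α hα.le hα1 k
  have h2 := hasSum_geom_aux (α * β) (by positivity) hab k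
  have h3 := hasSum_geom_aux (α * γ) (by positivity) hag k
  have h4 := h2.add ((h1.sub h3).mul_left t)
  have h5 : (∑' j : {j : ℕ // k ≤ j}, α ^ (j : ℕ) * (β ^ (j : ℕ) + t * (1 - γ ^ (j : ℕ)))) =
      (α * β) ^ k * (1 - α * β)⁻¹ + t * (α ^ k * (1 - α)⁻¹ - (α * γ) ^ k * (1 - α * γ)⁻¹) := by
    rw [← h4.tsum_eq]
    congr 1
    ext j
    rw [mul_pow, mul_pow]
    ring
  unfold barycenter
  rw [h5, h1.tsum_eq, mul_pow, mul_pow]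
  have e1 : 1 - α ≠ 0 := by linarith
  have e2 : 1 - α * β ≠ 0 := by linarith
  have e3 : 1 - α * γ ≠ 0 := by linarith
  field_simp

/-- For every `k > 1` there exists `τ_k ∈ (t_k, t_{k-1})` with `x_{k+1}(τ_k) > b_k(τ_k)`. -/
theorem exists_time_ahead_of_barycenter (α β γ : ℝ) (hβ : 0 < β) (hβγ : β < γ)
    (hγ1 : γ < 1) (hα : 0 < α) (hα1 : α < 1 / (1 + β + γ)) (k : ℕ) (hk : 1 < k) :
    ∃ τ : ℝ, collisionTime α β γ k < τ ∧ τ < collisionTime α β γ (k - 1) ∧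
      freeTraj β γ (k + 1) τ > barycenter α β γ k τ := by
  have hγ : 0 < γ := hβ.trans hβγ
  rw [lt_div_iff₀ (by linarith)] at hα1
  have pb : 0 < α * β := by positivity
  have pg : 0 < α * γ := by positivity
  have dα : 0 < 1 - α := by linarith
  have dB : 0 < 1 - α * β := by linarith
  have dG : 0 < 1 - α * γ := by linarith
  have dg : 0 < 1 - γ := by linarith
  have db : 0 < 1 - β := by linarith
  have ng : 0 < 1 - α - α * γ := by linarith
  have nb : 0 < 1 - α - α * β := by linarith
  have hR : (1 - α - α * β) / (1 - α - α * γ) < γ / β := by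
    rw [div_lt_div_iff₀ ng hβ]
    nlinarith [mul_pos (sub_pos.2 hβγ) (show 0 < 1 - α * (1 + β + γ) by linarith)]
  have hR1 : 1 < (1 - α - α * β) / (1 - α - α * γ) := by
    rw [one_lt_div ng]
    nlinarith
  obtain ⟨s, hs1, hs2⟩ := exists_between hR
  obtain ⟨m, rfl⟩ : ∃ m, k = m + 1 := ⟨k - 1, by omega⟩
  have hT : 0 < collisionTime α β γ (m + 1) := by unfold collisionTime; positivity
  refine ⟨collisionTime α β γ (m + 1) * s, ?_, ?_, ?_⟩
  · exact lt_mul_of_one_lt_right hT (hR1.trans hs1)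
  · have : collisionTime α β γ (m + 1 - 1) = collisionTime α β γ (m + 1) * (γ / β) := by
      unfold collisionTime
      rw [Nat.add_sub_cancel, pow_succ]
      field_simp
    rw [this]
    exact mul_lt_mul_of_pos_left hs2 hT
  · rw [barycenter_eq_aux α β γ hα (by linarith) hβ (by linarith) hγ hγ1]
    rw [div_lt_iff₀ ng] at hs1
    generalize m + 1 = k
    have key : freeTraj β γ (k + 1) (collisionTime α β γ k * s) -
        ((1 - α) / (1 - α * β) * β ^ k +
          collisionTime α β γ k * s * (1 - (1 - α) / (1 - α * γ) * γ ^ k)) =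
        β ^ k * (1 - β) / (1 - α * β) * (s * (1 - α - α * γ) - (1 - α - α * β)) := by
      unfold freeTraj collisionTime
      rw [div_pow, pow_succ, pow_succ]
      have e1 := dB.ne'
      have e2 := dG.ne'
      have e3 := dg.ne'
      have e4 : 1 - β * α ≠ 0 := by rw [mul_comm]; exact e1
      have e5 : 1 - γ * α ≠ 0 := by rw [mul_comm]; exact e2
      field_simp
      ring
    have : 0 < β ^ k * (1 - β) / (1 - α * β) * (s * (1 - α - α * γ) - (1 - α - α * β)) :=
      mul_pos (by positivity) (by linarith)
    linarith
end

section
/- (Example 1) Let m_i > 0 with Σ_i m_i < ∞, and let x̄_i, v̄_i ∈ ℝⁿ (i ∈ ℕ) satisfy Σ_i m_i|v̄_i|² < ∞ and (x̄_i, v̄_i) ≠ (x̄_j, v̄_j) for i ≠ j. Then the family of free trajectories x_i(t) = x̄_i + t v̄_i, i ∈ ℕ, is a weak solution of the sticky particle system: for every i and t ≥ 0, x_i(t) = x̄_i + ∫₀ᵗ V_i(s) ds, where V_i(s) = (Σ_{j∈J_i(s)} m_j v̄_j)/(Σ_{j∈J_i(s)} m_j) and J_i(s) = {j : x_j(s)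 = x_i(s)}. -/
open Set

/-- The common velocity, at time `s`, of the cluster of particles occupying the same
position as the `i`-th particle: the total momentum of the cluster divided by its total
mass, where `J_i(s) = {j : x_j(s) = x_i(s)}`. -/
noncomputable def stickyVel {ι : Type*} {n : ℕ} (m : ι → ℝ)
    (vInit : ι → EuclideanSpace ℝ (Fin n)) (x : ι → ℝ → EuclideanSpace ℝ (Fin n))
    (i : ι) (s : ℝ) : EuclideanSpace ℝ (Fin n) :=
  (∑' j : {j : ι // x j s = x i s}, m (j : ι))⁻¹ •
    ∑' j : {j : ι // x j s = x i s}, m (j : ι) • vInit (j : ι)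

/-- Example 1: for countably many particles with pairwise distinct position–velocity data,
the free trajectories `x_i(t) = x̄_i + t v̄_i` form a weak solution of the sticky particle
system: `x_i(t) = x̄_i + ∫₀ᵗ V_i(s) ds` for every `i` and every `t ≥ 0`. -/
theorem free_flow_is_weak_solution (n : ℕ) (m : ℕ → ℝ) (hm : ∀ i, 0 < m i)
    (hM : Summable m) (xInit vInit : ℕ → EuclideanSpace ℝ (Fin n))
    (hE : Summable (fun i => m i * ‖vInit i‖ ^ 2))
    (hdist : ∀ i j : ℕ, i ≠ j → (xInit i, vInit i) ≠ (xInit j, vInit j)) :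
    ∀ i : ℕ, ∀ t : ℝ, 0 ≤ t →
      xInit i + t • vInit i =
        xInit i + ∫ s in (0 : ℝ)..t,
          stickyVel m vInit (fun j u => xInit j + u • vInit j) i s := by
  intro i t ht
  have hcount : (⋃ j ∈ {j : ℕ | j ≠ i},
      {s : ℝ | xInit j + s • vInit j = xInit i + s • vInit i}).Countable := by
    refine Set.Countable.biUnion (Set.to_countable _) ?_
    intro j hj
    refine Set.Subsingleton.countable ?_
    intro a ha b hb
    simp only [Set.mem_setOf_eq] at ha hb
    by_contra hab
    have h1 : (a - b) • (vInit j - vInit i) = 0 := by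
      have : (a - b) • (vInit j - vInit i) = ((xInit j + a • vInit j) - (xInit i + a • vInit i))
          - ((xInit j + b • vInit j) - (xInit i + b • vInit i)) := by module
      rw [this, ha, hb]; simp
    rcases smul_eq_zero.mp h1 with h | h
    · exact hab (sub_eq_zero.mp h)
    · have hv := sub_eq_zero.mp h
      rw [hv] at ha
      exact hdist j i hj (Prod.ext (add_right_cancel ha) hv)
  have hae : ∀ᵐ s : ℝ ∂MeasureTheory.volume, s ∈ Set.uIoc 0 t →
      stickyVel m vInit (fun j u => xInit j + u • vInit j) i s = vInit i := by
    filter_upwards [hcount.ae_notMem MeasureTheory.volume] with s hs _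
    have huniq : ∀ j, xInit j + s • vInit j = xInit i + s • vInit i → j = i := by
      intro j hj
      by_contra hne
      exact hs (Set.mem_biUnion (show j ∈ {j : ℕ | j ≠ i} from hne) hj)
    let u : Unique {j : ℕ // xInit j + s • vInit j = xInit i + s • vInit i} :=
      { default := ⟨i, rfl⟩
        uniq := fun a => Subtype.ext (huniq a.1 a.2) }
    unfold stickyVel
    have e1 : (∑' j : {j : ℕ // xInit j + s • vInit j = xInit i + s • vInit i}, m j) = m i :=
      (hasSum_unique _).tsum_eq
    have e2 : (∑' j : {j : ℕ // xInit j + s • vInit j = xInit i + s • vInit i},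
        m j • vInit j) = m i • vInit i :=
      (hasSum_unique _).tsum_eq
    refine (congrArg₂ (fun (a : ℝ) (b : EuclideanSpace ℝ (Fin n)) => a⁻¹ • b) e1 e2).trans ?_
    exact inv_smul_smul₀ (hm i).ne' _
  rw [intervalIntegral.integral_congr_ae hae]
  simp
end

section
/- (Example 3: non-uniqueness) There exist masses m_i = 2^{-i} (i ≥ 1) and initial positions x̄_i ∈ ℝ² and initial velocities v̄_i ∈ ℝ² with Σ_i m_i |v̄_i|² < ∞, such that the sticky particle system with data (m_i, x̄_i, v̄_i) admits two distinct sticky solutions on [0,∞): the free-flight solution x_i(t) = x̄_i + t v̄_i (in which no two particles ever occupy the same position at the same time), and a second sticky solution in which particles collide pairwise at times t_i = 2^{-i} and stick, so that for t ≥ 1/2 all the mass is concentrated in a single point. -/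
open Set

/-- Weak solution of the sticky particle system on `[0,∞)`. -/
def IsWeakSolution {ι : Type*} {n : ℕ} (m : ι → ℝ)
    (xInit vInit : ι → EuclideanSpace ℝ (Fin n))
    (x : ι → ℝ → EuclideanSpace ℝ (Fin n)) : Prop :=
  (∀ i, ContinuousOn (x i) (Ici (0 : ℝ))) ∧ (∀ i, x i 0 = xInit i) ∧
    ∀ i, ∀ t : ℝ, 0 ≤ t → x i t = xInit i + ∫ s in (0 : ℝ)..t, stickyVel m vInit x i s

/-- Sticky solution: a weak solution such that particles occupying the same position at
some time occupy the same position at all later times. -/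
def IsStickySolution {ι : Type*} {n : ℕ} (m : ι → ℝ)
    (xInit vInit : ι → EuclideanSpace ℝ (Fin n))
    (x : ι → ℝ → EuclideanSpace ℝ (Fin n)) : Prop :=
  IsWeakSolution m xInit vInit x ∧
    ∀ i j, ∀ t₀ : ℝ, 0 ≤ t₀ → x i t₀ = x j t₀ → ∀ t, t₀ ≤ t → x i t = x j t

open MeasureTheory

namespace StickyEx

/-- predicate used to locate the dyadic shell -/
def shell (s : ℝ) (n : ℕ) : Prop := s ≤ 0 ∨ (1 ≤ n ∧ ((2:ℝ)⁻¹)^n ≤ s)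

theorem shell_ex (s : ℝ) : ∃ n, shell s n := by
  by_cases h : s ≤ 0
  · exact ⟨0, Or.inl h⟩
  · push Not at h
    obtain ⟨n, hn⟩ := exists_pow_lt_of_lt_one h (by norm_num : (2:ℝ)⁻¹ < 1)
    refine ⟨n+1, Or.inr ⟨by omega, le_trans ?_ hn.le⟩⟩
    exact pow_le_pow_of_le_one (by norm_num) (by norm_num) (by omega)

open Classical in
noncomputable def kap (s : ℝ) : ℕ := Nat.find (shell_ex s)

open Classical in
theorem kap_le {s : ℝ} (hs : 0 < s) {n : ℕ} (hn : 1 ≤ n) : kap s ≤ n ↔ ((2:ℝ)⁻¹)^n ≤ s := by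
  constructor
  · intro h
    have := Nat.find_spec (shell_ex s)
    rcases this with h1 | ⟨_, h2⟩
    · linarith
    · exact le_trans (pow_le_pow_of_le_one (by norm_num) (by norm_num) h) h2
  · intro h
    exact Nat.find_min' _ (Or.inr ⟨hn, h⟩)

open Classical in
theorem one_le_kap {s : ℝ} (hs : 0 < s) : 1 ≤ kap s := by
  have := Nat.find_spec (shell_ex s)
  rcases this with h1 | ⟨h2, _⟩
  · linarith
  · exact h2

open Classical in
theorem meas_kap : Measurable kap := by
  unfold kap
  apply measurable_find
  intro k
  unfold shell
  apply MeasurableSet.union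
  · exact measurableSet_Iic
  · by_cases h : 1 ≤ k
    · have e : (fun x : ℝ => 1 ≤ k ∧ ((2:ℝ)⁻¹)^k ≤ x) = Set.Ici (((2:ℝ)⁻¹)^k) := by
        ext x; exact ⟨fun hx => hx.2, fun hx => ⟨h, hx⟩⟩
      rw [e]; exact measurableSet_Ici
    · have e : (fun x : ℝ => 1 ≤ k ∧ ((2:ℝ)⁻¹)^k ≤ x) = (∅ : Set ℝ) := by
        ext x; exact ⟨fun hx => h hx.1, fun hx => hx.elim⟩
      rw [e]; exact MeasurableSet.empty

theorem kap_eq {s : ℝ} {k : ℕ} (h1 : ((2:ℝ)⁻¹)^(k+1) ≤ s) (h2 : s < ((2:ℝ)⁻¹)^k) :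
    kap s = k + 1 := by
  have hs : 0 < s := lt_of_lt_of_le (by positivity) h1
  apply le_antisymm
  · exact (kap_le hs (by omega)).2 h1
  · by_contra h
    rcases Nat.eq_zero_or_pos k with rfl | hk
    · have := one_le_kap hs
      omega
    · have : kap s ≤ k := by omega
      rw [kap_le hs hk] at this
      linarith

noncomputable def w (l : ℝ) (s : ℝ) : ℝ := l ^ kap s

noncomputable def Cc (l : ℝ) (t : ℝ) : ℝ := ∫ s in (0:ℝ)..t, w l s

theorem w_int {l : ℝ} (hl : |l| ≤ 1) (a b : ℝ) : IntervalIntegrable (w l) volume a b := by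
  have hm : Measurable (w l) :=
    (measurable_from_nat (f := fun n : ℕ => l ^ n)).comp meas_kap
  refine (intervalIntegrable_const (c := (1:ℝ))).mono_fun hm.aestronglyMeasurable ?_
  refine Filter.Eventually.of_forall fun s => ?_
  simp only [w, norm_pow, Real.norm_eq_abs, abs_one]
  exact pow_le_one₀ (abs_nonneg _) hl

theorem Cc_sub {l : ℝ} (hl : |l| ≤ 1) (a b : ℝ) : ∫ s in a..b, w l s = Cc l b - Cc l a := by
  unfold Cc
  rw [eq_sub_iff_add_eq, add_comm]
  exact intervalIntegral.integral_add_adjacent_intervals (w_int hl _ _) (w_int hl _ _)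

theorem Cc_cont {l : ℝ} (hl : |l| ≤ 1) : Continuous (Cc l) :=
  intervalIntegral.continuous_primitive (fun a b => w_int hl a b) 0

theorem Cc_pow {l : ℝ} (hl : |l| ≤ 1) (k : ℕ) :
    Cc l (((2:ℝ)⁻¹)^k) = (l/2)^k * (l/(2-l)) := by
  have hl2 : (2 - l) ≠ 0 := by
    have := le_abs_self l
    intro h; linarith
  let G : ℕ → ℝ := fun k => Cc l (((2:ℝ)⁻¹)^k) - (l/2)^k * (l/(2-l))
  have hG : ∀ k, G (k+1) = G k := by
    intro k
    have h1 : ∫ s in (((2:ℝ)⁻¹)^(k+1))..(((2:ℝ)⁻¹)^k), w l s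
        = ∫ s in (((2:ℝ)⁻¹)^(k+1))..(((2:ℝ)⁻¹)^k), l^(k+1) := by
      apply intervalIntegral.integral_congr_Ioo_of_le
      · exact pow_le_pow_of_le_one (by norm_num) (by norm_num) (by omega)
      · intro s hs
        simp only [w]
        rw [kap_eq hs.1.le hs.2]
    rw [Cc_sub hl, intervalIntegral.integral_const, smul_eq_mul] at h1
    simp only [G]
    have h2 : (l/2)^k = l^k * ((2:ℝ)⁻¹)^k := by rw [← mul_pow]; rfl
    have h3 : (l/2)^(k+1) = l^(k+1) * ((2:ℝ)⁻¹)^(k+1) := by rw [← mul_pow]; rfl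
    rw [h2, h3]
    have h4 : l^(k+1) * ((2:ℝ)⁻¹)^(k+1) * (l/(2-l)) - l^k * ((2:ℝ)⁻¹)^k * (l/(2-l))
       = - ((((2:ℝ)⁻¹)^k - ((2:ℝ)⁻¹)^(k+1)) * l^(k+1)) := by
      rw [pow_succ, pow_succ]
      field_simp
      ring
    linarith
  have hconst : ∀ n, G (k + n) = G k := by
    intro n
    induction n with
    | zero => rfl
    | succ n ih => rw [← ih, ← hG (k+n)]; rfl
  have hlim : Filter.Tendsto G Filter.atTop (nhds 0) := by
    have h1 : Filter.Tendsto (fun k : ℕ => ((2:ℝ)⁻¹)^k) Filter.atTop (nhds 0) :=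
      tendsto_pow_atTop_nhds_zero_of_lt_one (by norm_num) (by norm_num)
    have h2 : Filter.Tendsto (fun k : ℕ => (l/2)^k) Filter.atTop (nhds 0) := by
      apply tendsto_pow_atTop_nhds_zero_of_abs_lt_one
      rw [abs_div, abs_two]; linarith
    have h3 := ((Cc_cont hl).tendsto 0).comp h1
    have h4 := h3.sub (h2.mul_const (l/(2-l)))
    have h6 : Cc l 0 - 0 * (l/(2-l)) = 0 := by simp [Cc]
    rw [h6] at h4
    exact h4
  have : G k = 0 := by
    have h5 : Filter.Tendsto (fun n => G (k + n)) Filter.atTop (nhds 0) :=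
      hlim.comp (Filter.tendsto_atTop_mono (fun n => Nat.le_add_left n k) Filter.tendsto_id)
    simp only [hconst] at h5
    exact tendsto_nhds_unique tendsto_const_nhds h5
  simp only [G] at this
  linarith

noncomputable def P (a b : ℝ) : EuclideanSpace ℝ (Fin 2) :=
  a • EuclideanSpace.single 0 (1:ℝ) + b • EuclideanSpace.single 1 (1:ℝ)

theorem P_inj {a b c d : ℝ} : P a b = P c d ↔ a = c ∧ b = d := by
  constructor
  · intro h
    have h0 := congrArg (fun v : EuclideanSpace ℝ (Fin 2) => v 0) h
    have h1 := congrArg (fun v : EuclideanSpace ℝ (Fin 2) => v 1) h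
    simp [P] at h0 h1
    exact ⟨h0, h1⟩
  · rintro ⟨rfl, rfl⟩; rfl

theorem P_add (a b c d : ℝ) : P a b + P c d = P (a+c) (b+d) := by
  simp only [P]; module

theorem P_smul (t a b : ℝ) : t • P a b = P (t*a) (t*b) := by
  simp only [P]; module

theorem P_hasSum {ι : Type*} {f g : ι → ℝ} {a b : ℝ} (hf : HasSum f a) (hg : HasSum g b) :
    HasSum (fun i => P (f i) (g i)) (P a b) :=
  (hf.smul_const _).add (hg.smul_const _)

theorem P_cont {f g : ℝ → ℝ} (hf : Continuous f) (hg : Continuous g) :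
    Continuous (fun i => P (f i) (g i)) := by
  unfold P; fun_prop

theorem P_int {f g : ℝ → ℝ} {a b : ℝ} (hf : IntervalIntegrable f volume a b)
    (hg : IntervalIntegrable g volume a b) :
    IntervalIntegrable (fun s => P (f s) (g s)) volume a b ∧
    ∫ s in a..b, P (f s) (g s) = P (∫ s in a..b, f s) (∫ s in a..b, g s) := by
  have h1 : IntervalIntegrable (fun s => f s • (EuclideanSpace.single 0 (1:ℝ) : EuclideanSpace ℝ (Fin 2))) volume a b :=
    ⟨hf.1.smul_const _, hf.2.smul_const _⟩
  have h2 : IntervalIntegrable (fun s => g s • (EuclideanSpace.single 1 (1:ℝ) : EuclideanSpace ℝ (Fin 2))) volume a b :=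
    ⟨hg.1.smul_const _, hg.2.smul_const _⟩
  refine ⟨h1.add h2, ?_⟩
  unfold P
  rw [intervalIntegral.integral_add h1 h2, intervalIntegral.integral_smul_const,
    intervalIntegral.integral_smul_const]

noncomputable def pos (l : ℝ) (k : ℕ) (t : ℝ) : ℝ :=
  (l/2)^k * (l/(2-l)) + (t - ((2:ℝ)⁻¹)^k) * ((2-l) * l^k)

theorem pos_eq {l : ℝ} (hl : |l| ≤ 1) (k : ℕ) : pos l k (((2:ℝ)⁻¹)^k) = Cc l (((2:ℝ)⁻¹)^k) := by
  rw [Cc_pow hl]; simp [pos]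

theorem pos_ne {i j : ℕ} (hij : i ≠ j) {t : ℝ} (h1 : pos (-1) i t = pos (-1) j t)
    (h2 : pos (1/4) i t = pos (1/4) j t) : False := by
  have e1 : ∀ k, pos (-1) k t = (-1)^k * (3*t - (10/3) * ((2:ℝ)⁻¹)^k) := by
    intro k
    have : ((-1:ℝ)/2)^k = (-1)^k * ((2:ℝ)⁻¹)^k := by rw [← mul_pow]; rfl
    simp only [pos]; rw [this]; ring
  have e2 : ∀ k, pos (1/4) k t = (((2:ℝ)⁻¹)^k)^2 * ((7/4)*t - (45/28) * ((2:ℝ)⁻¹)^k) := by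
    intro k
    have a1 : ((1:ℝ)/4)^k = (((2:ℝ)⁻¹)^k)^2 := by rw [← pow_mul, mul_comm, pow_mul]; norm_num
    have a2 : ((1:ℝ)/4/2)^k = (((2:ℝ)⁻¹)^k)^2 * ((2:ℝ)⁻¹)^k := by
      rw [← a1, ← mul_pow]; norm_num
    simp only [pos]; rw [a2, a1]; ring
  rw [e1, e1] at h1
  rw [e2, e2] at h2
  have hp : 0 < ((2:ℝ)⁻¹)^i := by positivity
  have hq : 0 < ((2:ℝ)⁻¹)^j := by positivity
  have hpq : ((2:ℝ)⁻¹)^i ≠ ((2:ℝ)⁻¹)^j := by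
    intro h
    exact hij (pow_right_injective₀ (by norm_num) (by norm_num) h)
  generalize ((2:ℝ)⁻¹)^i = p at *
  generalize ((2:ℝ)⁻¹)^j = q at *
  have key : t = 5/9*(p+q) → False := by
    intro ht
    subst ht
    have : (p - q) * ((p+q)^2 * (35/36) - 45/28 * (p^2+p*q+q^2)) = 0 := by
      linear_combination h2
    rcases mul_eq_zero.1 this with h | h
    · exact hpq (by linarith)
    · nlinarith [sq_nonneg (p-q), mul_pos hp hq, mul_pos hp hp, mul_pos hq hq]
  rcases neg_one_pow_eq_or ℝ i with hi | hi <;> rcases neg_one_pow_eq_or ℝ j with hj | hj <;>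
    rw [hi, hj] at h1
  · exact hpq (by linarith)
  · exact key (by linarith)
  · exact key (by linarith)
  · exact hpq (by linarith)

theorem Cc_ne {i : ℕ} (hi : 1 ≤ i) {t : ℝ} (ht : 0 < t) (h : t < ((2:ℝ)⁻¹)^i) :
    pos (1/4) i t < Cc (1/4) t := by
  have hl : |(1/4:ℝ)| ≤ 1 := by rw [abs_of_pos] <;> norm_num
  have h1 : ∫ s in t..(((2:ℝ)⁻¹)^i), w (1/4) s ≤ ∫ s in t..(((2:ℝ)⁻¹)^i), (1/4:ℝ)^i := by
    apply intervalIntegral.integral_mono_on_of_le_Ioo h.le (w_int hl _ _)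
      intervalIntegrable_const
    intro s hs
    apply pow_le_pow_of_le_one (by norm_num) (by norm_num)
    by_contra hc
    have := (kap_le (lt_trans ht hs.1) hi).1 (by omega)
    linarith [hs.2]
  rw [Cc_sub hl, intervalIntegral.integral_const, smul_eq_mul, ← pos_eq hl] at h1
  have h3 : 0 < (((2:ℝ)⁻¹)^i - t) * (1/4:ℝ)^i := mul_pos (by linarith) (by positivity)
  simp only [pos] at h1 ⊢
  nlinarith

abbrev E := EuclideanSpace ℝ (Fin 2)
abbrev I := {i : ℕ // 1 ≤ i}

noncomputable def vel (k : ℕ) : E := P ((2-(-1)) * (-1)^k) ((2-1/4) * (1/4)^k)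
noncomputable def pp (k : ℕ) (t : ℝ) : E := P (pos (-1) k t) (pos (1/4) k t)
noncomputable def CC (t : ℝ) : E := P (Cc (-1) t) (Cc (1/4) t)
noncomputable def WW (s : ℝ) : E := P (w (-1) s) (w (1/4) s)
noncomputable def Y (k : ℕ) (t : ℝ) : E := if ((2:ℝ)⁻¹)^k ≤ t then CC t else pp k t

theorem hl1 : |(-1:ℝ)| ≤ 1 := by simp
theorem hl2 : |(1/4:ℝ)| ≤ 1 := by rw [abs_of_pos] <;> norm_num

theorem pp_free (k : ℕ) (t : ℝ) : pp k 0 + t • vel k = pp k t := by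
  simp only [pp, vel, P_smul, P_add, pos]
  rw [P_inj]; constructor <;> ring

theorem pp_inj {i j : ℕ} {t : ℝ} (h : pp i t = pp j t) : i = j := by
  by_contra hij
  obtain ⟨h1, h2⟩ := P_inj.1 h
  exact pos_ne hij h1 h2

theorem pp_CC (k : ℕ) : pp k (((2:ℝ)⁻¹)^k) = CC (((2:ℝ)⁻¹)^k) := by
  simp only [pp, CC, pos_eq hl1, pos_eq hl2]

theorem Y_eq_iff {i j : ℕ} (hi : 1 ≤ i) (hj : 1 ≤ j) {t : ℝ} (ht : 0 ≤ t) :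
    Y i t = Y j t ↔ i = j ∨ (((2:ℝ)⁻¹)^i ≤ t ∧ ((2:ℝ)⁻¹)^j ≤ t) := by
  constructor
  · intro h
    unfold Y at h
    split_ifs at h with h1 h2 h2
    · exact Or.inr ⟨h1, h2⟩
    · exfalso
      have := (P_inj.1 h).2
      push Not at h2
      have h0 : 0 < t := lt_of_lt_of_le (by positivity) h1
      linarith [Cc_ne hj h0 h2]
    · exfalso
      have := (P_inj.1 h).2
      push Not at h1
      have h0 : 0 < t := lt_of_lt_of_le (by positivity) h2
      linarith [Cc_ne hi h0 h1]
    · exact Or.inl (pp_inj h)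
  · rintro (rfl | ⟨h1, h2⟩)
    · rfl
    · rw [Y, Y, if_pos h1, if_pos h2]

theorem Y_cont (k : ℕ) : Continuous (Y k) := by
  unfold Y
  apply Continuous.if_le
  · exact P_cont (Cc_cont hl1) (Cc_cont hl2)
  · apply P_cont <;> (unfold pos; fun_prop)
  · fun_prop
  · fun_prop
  · rintro t rfl
    exact (pp_CC k).symm

/-- velocity of isolated particle -/
theorem stickyVel_single (m : I → ℝ) (hm : ∀ i, m i ≠ 0) (v : I → E) (x : I → ℝ → E) (i : I)
    (s : ℝ) (h : ∀ j, x j s = x i s → j = i) : stickyVel m v x i s = v i := by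
  unfold stickyVel
  let u : Unique {j : I // x j s = x i s} :=
    { default := ⟨i, rfl⟩, uniq := fun j => Subtype.ext (h j.1 j.2) }
  rw [tsum_eq_single (default : {j : I // x j s = x i s}) (fun b hb => absurd (u.uniq b) hb),
    tsum_eq_single (default : {j : I // x j s = x i s}) (fun b hb => absurd (u.uniq b) hb)]
  change (m i)⁻¹ • m i • v i = v i
  rw [smul_smul, inv_mul_cancel₀ (hm i), one_smul]

theorem geo {l : ℝ} (hl : |l| ≤ 1) (K : ℕ) :
    HasSum (fun n : ℕ => ((2:ℝ)⁻¹)^(K+n) * ((2-l) * l^(K+n))) (2 * ((2:ℝ)⁻¹)^K * l^K) := by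
  have hl2 : (2 - l) ≠ 0 := by
    have := le_abs_self l
    intro h; linarith
  have h : HasSum (fun n : ℕ => (l/2)^n) (1 - l/2)⁻¹ := by
    apply hasSum_geometric_of_abs_lt_one
    rw [abs_div, abs_two]; linarith
  have h2 := h.mul_left (((2:ℝ)⁻¹)^K * ((2-l) * l^K))
  have e1 : (fun n : ℕ => ((2:ℝ)⁻¹)^(K+n) * ((2-l) * l^(K+n)))
      = fun n : ℕ => ((2:ℝ)⁻¹)^K * ((2-l) * l^K) * (l/2)^n := by
    funext n
    rw [div_pow, pow_add, pow_add, inv_pow 2 n]; ring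
  have e2 : 2 * ((2:ℝ)⁻¹)^K * l^K = ((2:ℝ)⁻¹)^K * ((2-l) * l^K) * (1 - l/2)⁻¹ := by
    have e : (1 - l/2)⁻¹ = 2 / (2-l) := by
      rw [inv_eq_iff_eq_inv, inv_div]; ring
    rw [e]; field_simp
  rw [e1, e2]
  exact h2

theorem stickyVel_cluster (x : I → ℝ → E) (i : I) (s : ℝ) (hs : 0 < s)
    (h : ∀ j : I, x j s = x i s ↔ kap s ≤ j.1) :
    stickyVel (fun i : I => ((2 : ℝ)⁻¹) ^ (i : ℕ)) (fun i => vel i.1) x i s = WW s := by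
  unfold stickyVel
  let e : ℕ ≃ {j : I // x j s = x i s} :=
    { toFun := fun n => ⟨⟨kap s + n, le_trans (one_le_kap hs) (Nat.le_add_right _ _)⟩,
        (h _).2 (Nat.le_add_right _ _)⟩
      invFun := fun j => j.1.1 - kap s
      left_inv := fun n => by simp
      right_inv := fun j => by
        apply Subtype.ext; apply Subtype.ext
        have := (h j.1).1 j.2
        simp only
        omega }
  rw [← e.tsum_eq, ← e.tsum_eq]
  have h1 : ∑' n, ((2 : ℝ)⁻¹) ^ (((e n).1 : I) : ℕ) = 2 * ((2:ℝ)⁻¹)^(kap s) := by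
    have := geo (l := 1) (by simp) (kap s)
    norm_num at this
    norm_num
    exact this.tsum_eq
  have h2 : ∑' n, ((2 : ℝ)⁻¹) ^ (((e n).1 : I) : ℕ) • vel (((e n).1 : I) : ℕ)
      = (2 * ((2:ℝ)⁻¹)^(kap s)) • WW s := by
    have := P_hasSum (geo hl1 (kap s)) (geo hl2 (kap s))
    simp only [WW, w, P_smul]
    rw [← this.tsum_eq]
    apply tsum_congr
    intro n
    simp only [vel, P_smul]
    rfl
  rw [h1, h2, smul_smul, inv_mul_cancel₀ (by positivity), one_smul]

theorem Y_vel (i : I) {s : ℝ} (hs : 0 ≤ s) :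
    stickyVel (fun i : I => ((2 : ℝ)⁻¹) ^ (i : ℕ)) (fun i => vel i.1) (fun i => Y i.1) i s
     = if ((2:ℝ)⁻¹)^i.1 ≤ s then WW s else vel i.1 := by
  split_ifs with h
  · have h0 : 0 < s := lt_of_lt_of_le (by positivity) h
    apply stickyVel_cluster _ _ _ h0
    intro j
    rw [Y_eq_iff j.2 i.2 hs, kap_le h0 j.2]
    constructor
    · rintro (h1 | h1)
      · rw [h1]; exact h
      · exact h1.1
    · intro h1; exact Or.inr ⟨h1, h⟩
  · apply stickyVel_single _ (fun i => by positivity)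
    intro j hj
    rw [Y_eq_iff j.2 i.2 hs] at hj
    rcases hj with h1 | h1
    · exact Subtype.ext h1
    · exact absurd h1.2 h

theorem Y_weak (i : I) {t : ℝ} (ht : 0 ≤ t) :
    Y i.1 t = pp i.1 0 + ∫ s in (0:ℝ)..t,
      stickyVel (fun i : I => ((2 : ℝ)⁻¹) ^ (i : ℕ)) (fun i => vel i.1) (fun i => Y i.1) i s := by
  have e1 : ∀ r, 0 ≤ r → r ≤ ((2:ℝ)⁻¹)^i.1 → 
      Set.EqOn (fun s => stickyVel (fun i : I => ((2 : ℝ)⁻¹) ^ (i : ℕ)) (fun i => vel i.1)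
        (fun i => Y i.1) i s) (fun _ => vel i.1) (Set.Ioo 0 r) := by
    intro r hr hr2 s hs
    simp only
    rw [Y_vel i hs.1.le, if_neg]
    linarith [hs.2]
  have f1 : ∀ r, 0 ≤ r → r ≤ ((2:ℝ)⁻¹)^i.1 → ∫ s in (0:ℝ)..r,
      stickyVel (fun i : I => ((2 : ℝ)⁻¹) ^ (i : ℕ)) (fun i => vel i.1) (fun i => Y i.1) i s
      = r • vel i.1 := by
    intro r hr hr2
    rw [intervalIntegral.integral_congr_Ioo_of_le hr (e1 r hr hr2)]
    simp
  by_cases h : ((2:ℝ)⁻¹)^i.1 ≤ t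
  · have hp : (0:ℝ) ≤ ((2:ℝ)⁻¹)^i.1 := by positivity
    have e2 : Set.EqOn (fun s => stickyVel (fun i : I => ((2 : ℝ)⁻¹) ^ (i : ℕ)) (fun i => vel i.1)
        (fun i => Y i.1) i s) WW (Set.Ioo (((2:ℝ)⁻¹)^i.1) t) := by
      intro s hs
      simp only
      rw [Y_vel i (hp.trans hs.1.le), if_pos hs.1.le]
    have hW := P_int (w_int hl1 (((2:ℝ)⁻¹)^i.1) t) (w_int hl2 (((2:ℝ)⁻¹)^i.1) t)
    have i1 := (intervalIntegrable_const (c := vel i.1) (a := 0) (b := ((2:ℝ)⁻¹)^i.1) (μ := volume)).congr_uIoo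
      (by rw [Set.uIoo_of_le hp]; exact (e1 _ hp le_rfl).symm)
    have i2 := hW.1.congr_uIoo
      (by rw [Set.uIoo_of_le h]; exact e2.symm)
    rw [← intervalIntegral.integral_add_adjacent_intervals i1 i2, f1 _ hp le_rfl,
      intervalIntegral.integral_congr_Ioo_of_le h e2, ← add_assoc, pp_free, pp_CC]
    unfold WW
    rw [hW.2, Cc_sub hl1, Cc_sub hl2]
    simp only [Y, if_pos h, CC, P_add]
    rw [P_inj]; constructor <;> ring
  · rw [f1 t ht (by linarith), pp_free, Y, if_neg h]

end StickyEx

/-- Example 3: non-uniqueness of sticky solutions.  There are countably many particles in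
the plane, with masses `m_i = 2^{-i}` (`i ≥ 1`) and finite total energy, whose Cauchy
problem admits two distinct sticky solutions: the free-flight solution, in which no two
particles ever collide, and a second sticky solution in which the particles collide
pairwise at the times `t_i = 2^{-i}` (so that during `[t_{k+1}, t_k)` exactly `k+1`
distinct compound particles are present) and all the mass is concentrated in one single
point for `t ≥ 1/2`. -/
theorem sticky_solution_nonuniqueness :
    ∃ xInit vInit : {i : ℕ // 1 ≤ i} → EuclideanSpace ℝ (Fin 2),
      Summable (fun i : {i : ℕ // 1 ≤ i} => ((2 : ℝ)⁻¹) ^ (i : ℕ) * ‖vInit i‖ ^ 2) ∧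
      (∀ i j : {i : ℕ // 1 ≤ i}, i ≠ j → ∀ t : ℝ, 0 ≤ t →
        xInit i + t • vInit i ≠ xInit j + t • vInit j) ∧
      IsStickySolution (fun i : {i : ℕ // 1 ≤ i} => ((2 : ℝ)⁻¹) ^ (i : ℕ)) xInit vInit
        (fun i t => xInit i + t • vInit i) ∧
      ∃ y : {i : ℕ // 1 ≤ i} → ℝ → EuclideanSpace ℝ (Fin 2),
        IsStickySolution (fun i : {i : ℕ // 1 ≤ i} => ((2 : ℝ)⁻¹) ^ (i : ℕ)) xInit vInit y ∧
        y ≠ (fun i t => xInit i + t • vInit i) ∧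
        (∀ t : ℝ, 1 / 2 ≤ t → ∀ i j : {i : ℕ // 1 ≤ i}, y i t = y j t) ∧
        (∀ k : ℕ, 1 ≤ k → ∀ t : ℝ, ((2 : ℝ)⁻¹) ^ (k + 1) ≤ t → t < ((2 : ℝ)⁻¹) ^ k →
          Set.ncard {p : EuclideanSpace ℝ (Fin 2) | ∃ i, y i t = p} = k + 1) := by
  open StickyEx in
  refine ⟨fun i => pp i.1 0, fun i => vel i.1, ?_, ?_, ⟨⟨?_, ?_, ?_⟩, ?_⟩, fun i => Y i.1,
    ⟨⟨?_, ?_, ?_⟩, ?_⟩, ?_, ?_, ?_⟩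
  · have hb : ∀ k, ‖vel k‖ ≤ 5 := by
      intro k
      unfold vel P
      refine (norm_add_le _ _).trans ?_
      rw [norm_smul, norm_smul]
      simp only [EuclideanSpace.norm_single, norm_one, mul_one, norm_mul, norm_pow, norm_neg, one_pow]
      have : ‖(1/4:ℝ)‖^k ≤ 1 := pow_le_one₀ (norm_nonneg _) (by norm_num)
      norm_num at this ⊢
      linarith
    have hg : Summable (fun i : {i : ℕ // 1 ≤ i} => ((2 : ℝ)⁻¹) ^ (i : ℕ) * 25) :=
      ((summable_geometric_of_lt_one (by norm_num) (by norm_num)).mul_right 25).comp_injective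
        Subtype.val_injective
    refine hg.of_nonneg_of_le (fun i => by positivity) (fun i => ?_)
    have := hb i.1
    have h0 := norm_nonneg (vel i.1)
    apply mul_le_mul_of_nonneg_left _ (by positivity)
    nlinarith
  · intro i j hij t _ h
    simp only [pp_free] at h
    exact hij (Subtype.ext (pp_inj h))
  · intro i
    fun_prop
  · intro i; simp
  · intro i t ht
    have : ∀ s, stickyVel (fun i : {i : ℕ // 1 ≤ i} => ((2 : ℝ)⁻¹) ^ (i : ℕ)) (fun i => vel i.1)
        (fun i t => pp i.1 0 + t • vel i.1) i s = vel i.1 := by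
      intro s
      apply stickyVel_single _ (fun i => by positivity)
      intro j hj
      simp only [pp_free] at hj
      exact Subtype.ext (pp_inj hj)
    simp only [this]
    simp
  · intro i j t₀ _ h t _
    simp only [pp_free] at h
    rw [Subtype.ext (pp_inj h)]
  · intro i; exact (Y_cont i.1).continuousOn
  · intro i
    have : ¬ ((2:ℝ)⁻¹)^i.1 ≤ 0 := by
      push Not; positivity
    simp only [Y, if_neg this]
  · intro i t ht
    exact Y_weak i ht
  · intro i j t₀ h0 h t ht
    simp only at h ⊢
    rw [Y_eq_iff i.2 j.2 h0] at h
    rw [Y_eq_iff i.2 j.2 (h0.trans ht)]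
    rcases h with h | h
    · exact Or.inl h
    · exact Or.inr ⟨h.1.trans ht, h.2.trans ht⟩
  · intro h
    have a1 := congrFun (congrFun h ⟨1, le_rfl⟩) (1/2)
    have a2 := congrFun (congrFun h ⟨2, by norm_num⟩) (1/2)
    simp only [pp_free] at a1 a2
    have a3 : Y 1 (1/2) = Y 2 (1/2) := by
      rw [Y_eq_iff le_rfl (by norm_num) (by norm_num)]
      right; norm_num
    rw [a1, a2] at a3
    exact absurd (pp_inj a3) (by norm_num)
  · intro t ht i j
    simp only
    rw [Y_eq_iff i.2 j.2 (by linarith)]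
    right
    have : ∀ k : ℕ, 1 ≤ k → ((2:ℝ)⁻¹)^k ≤ t := by
      intro k hk
      have := pow_le_pow_of_le_one (by norm_num : (0:ℝ) ≤ 2⁻¹) (by norm_num) hk
      norm_num at this ht ⊢
      linarith
    exact ⟨this _ i.2, this _ j.2⟩
  · intro k hk t h1 h2
    have ht : 0 < t := lt_of_lt_of_le (by positivity) h1
    have hkap := kap_eq h1 h2
    have hset : {p : EuclideanSpace ℝ (Fin 2) | ∃ i : {i : ℕ // 1 ≤ i}, Y i.1 t = p}
        = (fun n => Y n t) '' (Set.Icc 1 (k+1)) := by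
      ext p
      constructor
      · rintro ⟨i, rfl⟩
        by_cases hi : i.1 ≤ k + 1
        · exact ⟨i.1, ⟨i.2, hi⟩, rfl⟩
        · refine ⟨k+1, ⟨by omega, le_rfl⟩, ?_⟩
          simp only
          rw [Y_eq_iff (by omega) i.2 ht.le]
          right
          exact ⟨h1, (kap_le ht i.2).1 (by omega)⟩
      · rintro ⟨n, hn, rfl⟩
        exact ⟨⟨n, hn.1⟩, rfl⟩
    rw [hset, Set.InjOn.ncard_image]
    · rw [Set.ncard_eq_toFinset_card']; simp
    · intro a ha b hb hab
      simp only at hab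
      rw [Y_eq_iff ha.1 hb.1 ht.le] at hab
      rcases hab with h | ⟨h, h'⟩
      · exact h
      · rw [← kap_le ht ha.1] at h
        rw [← kap_le ht hb.1] at h'
        have := ha.2
        have := hb.2
        omega
end

section
/- (Example 4: non-existence) There exist masses m_i > 0 with Σ_i m_i < ∞ and initial positions x̄_i ∈ ℝ² and initial velocities v̄_i ∈ ℝ² (i ∈ ℕ) with Σ_i m_i|v̄_i|² < ∞, such that for every T > 0 the sticky particle system with data (m_i, x̄_i, v̄_i) admits no sticky solution on the time interval [0,T]. -/
open Set

/-- Weak solution of the sticky particle system on the time interval `[0, T]`. -/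
def IsWeakSolutionOn {ι : Type*} {n : ℕ} (T : ℝ) (m : ι → ℝ)
    (xInit vInit : ι → EuclideanSpace ℝ (Fin n))
    (x : ι → ℝ → EuclideanSpace ℝ (Fin n)) : Prop :=
  (∀ i, ContinuousOn (x i) (Icc (0 : ℝ) T)) ∧ (∀ i, x i 0 = xInit i) ∧
    ∀ i, ∀ t ∈ Icc (0 : ℝ) T, x i t = xInit i + ∫ s in (0 : ℝ)..t, stickyVel m vInit x i s

/-- Sticky solution on `[0, T]`: a weak solution such that particles occupying the same
position at some time `t₀ ∈ [0, T]` occupy the same position at all later times in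
`[t₀, T]`. -/
def IsStickySolutionOn {ι : Type*} {n : ℕ} (T : ℝ) (m : ι → ℝ)
    (xInit vInit : ι → EuclideanSpace ℝ (Fin n))
    (x : ι → ℝ → EuclideanSpace ℝ (Fin n)) : Prop :=
  IsWeakSolutionOn T m xInit vInit x ∧
    ∀ i j, ∀ t₀ ∈ Icc (0 : ℝ) T, x i t₀ = x j t₀ →
      ∀ t ∈ Icc t₀ T, x i t = x j t

open MeasureTheory

lemma sp_summable {m : ℕ → ℝ} {v : ℕ → EuclideanSpace ℝ (Fin 2)} {C : ℝ}
    (hm : ∀ i, 0 < m i) (hs : Summable m) (hb : ∀ j, ‖v j‖ ≤ C) :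
    Summable (fun j => m j • v j) := by
  refine Summable.of_norm_bounded (g := fun j => m j * C) (hs.mul_right C) ?_
  intro j
  rw [norm_smul, Real.norm_of_nonneg (hm j).le]
  exact mul_le_mul_of_nonneg_left (hb j) (hm j).le

lemma sp_eq {m : ℕ → ℝ} {v : ℕ → EuclideanSpace ℝ (Fin 2)} {C : ℝ}
    (hm : ∀ i, 0 < m i) (hs : Summable m) (hb : ∀ j, ‖v j‖ ≤ C)
    (x : ℕ → ℝ → EuclideanSpace ℝ (Fin 2)) (i : ℕ) (s : ℝ)
    (L : EuclideanSpace ℝ (Fin 2) →L[ℝ] ℝ) (c : ℝ) :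
    ∃ M : ℝ, 0 < M ∧ Summable (fun j : {j : ℕ // x j s = x i s} => m j * (L (v j) - c)) ∧
      L (stickyVel m v x i s) - c
        = M⁻¹ * ∑' j : {j : ℕ // x j s = x i s}, m j * (L (v j) - c) := by
  have hS : Summable (fun j : {j : ℕ // x j s = x i s} => m j) := hs.subtype _
  have hV : Summable (fun j : {j : ℕ // x j s = x i s} => m (j : ℕ) • v j) :=
    (sp_summable hm hs hb).subtype _
  have hLV : Summable (fun j : {j : ℕ // x j s = x i s} => m (j : ℕ) * L (v j)) := by
    have := hV.mapL L
    simpa using this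
  have hMpos : 0 < ∑' j : {j : ℕ // x j s = x i s}, m j :=
    hS.tsum_pos (fun j => (hm j).le) ⟨i, rfl⟩ (hm i)
  refine ⟨_, hMpos, ?_, ?_⟩
  · simpa [mul_sub] using hLV.sub (hS.mul_right c)
  · have h1 : ∑' j : {j : ℕ // x j s = x i s}, m j * (L (v j) - c)
        = ∑' j : {j : ℕ // x j s = x i s}, m j * L (v j)
          - (∑' j : {j : ℕ // x j s = x i s}, m j) * c := by
      rw [← tsum_mul_right, ← hLV.tsum_sub (hS.mul_right c)]
      simp [mul_sub]
    have h2 : L (∑' j : {j : ℕ // x j s = x i s}, m (j : ℕ) • v j)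
        = ∑' j : {j : ℕ // x j s = x i s}, m (j : ℕ) * L (v j) := by
      rw [L.map_tsum hV]; simp
    unfold stickyVel
    rw [map_smul, h2, h1, smul_eq_mul]
    field_simp

lemma sp_ge {m : ℕ → ℝ} {v : ℕ → EuclideanSpace ℝ (Fin 2)} {C : ℝ}
    (hm : ∀ i, 0 < m i) (hs : Summable m) (hb : ∀ j, ‖v j‖ ≤ C)
    (x : ℕ → ℝ → EuclideanSpace ℝ (Fin 2)) (i : ℕ) (s : ℝ)
    (L : EuclideanSpace ℝ (Fin 2) →L[ℝ] ℝ) (c : ℝ)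
    (h : ∀ j, x j s = x i s → c ≤ L (v j)) : c ≤ L (stickyVel m v x i s) := by
  obtain ⟨M, hM, _, he⟩ := sp_eq hm hs hb x i s L c
  have : 0 ≤ ∑' j : {j : ℕ // x j s = x i s}, m j * (L (v j) - c) :=
    tsum_nonneg fun j => mul_nonneg (hm j).le (sub_nonneg.2 (h j j.2))
  have := mul_nonneg (inv_nonneg.2 hM.le) this
  linarith

lemma sp_gt {m : ℕ → ℝ} {v : ℕ → EuclideanSpace ℝ (Fin 2)} {C : ℝ}
    (hm : ∀ i, 0 < m i) (hs : Summable m) (hb : ∀ j, ‖v j‖ ≤ C)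
    (x : ℕ → ℝ → EuclideanSpace ℝ (Fin 2)) (i : ℕ) (s : ℝ)
    (L : EuclideanSpace ℝ (Fin 2) →L[ℝ] ℝ) (c : ℝ)
    (h : ∀ j, x j s = x i s → c ≤ L (v j)) (k : ℕ) (hk : x k s = x i s) (hk' : c < L (v k)) :
    c < L (stickyVel m v x i s) := by
  obtain ⟨M, hM, hsm, he⟩ := sp_eq hm hs hb x i s L c
  have : 0 < ∑' j : {j : ℕ // x j s = x i s}, m j * (L (v j) - c) :=
    hsm.tsum_pos (fun j => mul_nonneg (hm j).le (sub_nonneg.2 (h j j.2))) ⟨k, hk⟩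
      (mul_pos (hm k) (sub_pos.2 hk'))
  have := mul_pos (inv_pos.2 hM) this
  linarith

lemma sp_const {m : ℕ → ℝ} {v : ℕ → EuclideanSpace ℝ (Fin 2)} {C : ℝ}
    (hm : ∀ i, 0 < m i) (hs : Summable m) (hb : ∀ j, ‖v j‖ ≤ C)
    (x : ℕ → ℝ → EuclideanSpace ℝ (Fin 2)) (i : ℕ) (s : ℝ)
    (L : EuclideanSpace ℝ (Fin 2) →L[ℝ] ℝ) (c : ℝ)
    (h : ∀ j, x j s = x i s → L (v j) = c) : L (stickyVel m v x i s) = c := by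
  apply le_antisymm
  · have := sp_ge hm hs hb x i s (-L) (-c) (fun j hj => by simp [h j hj])
    simpa using this
  · exact sp_ge hm hs hb x i s L c (fun j hj => by simp [h j hj])

lemma sp_meas {m : ℕ → ℝ} {v : ℕ → EuclideanSpace ℝ (Fin 2)} {C : ℝ}
    (hm : ∀ i, 0 < m i) (hs : Summable m) (hb : ∀ j, ‖v j‖ ≤ C)
    (x : ℕ → ℝ → EuclideanSpace ℝ (Fin 2)) (hx : ∀ i, Continuous (x i)) (i : ℕ) :
    Measurable (stickyVel m v x i) := by
  have key : ∀ {F : Type} [NormedAddCommGroup F] [CompleteSpace F] [MeasurableSpace F]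
      [BorelSpace F] [SecondCountableTopology F]
      (f : ℕ → F), Summable f →
      Measurable (fun s => ∑' j : {j : ℕ // x j s = x i s}, f j) := by
    intro F _ _ _ _ _ f hf
    have e : ∀ s, ∑' j : {j : ℕ // x j s = x i s}, f j
        = ∑' j, ({j : ℕ | x j s = x i s}).indicator f j := fun s => tsum_subtype _ f
    refine measurable_of_tendsto_metrizable
      (f := fun n s => ∑ j ∈ Finset.range n, ({j : ℕ | x j s = x i s}).indicator f j) ?_ ?_
    · intro n
      refine Finset.measurable_sum _ fun j _ => ?_
      have hset : MeasurableSet {s | x j s = x i s} :=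
        (isClosed_eq (hx j) (hx i)).measurableSet
      have : (fun s => ({j : ℕ | x j s = x i s}).indicator f j)
          = {s | x j s = x i s}.indicator (fun _ => f j) := by
        ext s; simp [Set.indicator]
      rw [this]
      exact measurable_const.indicator hset
    · rw [tendsto_pi_nhds]
      intro s
      rw [e s]
      apply HasSum.tendsto_sum_nat
      apply Summable.hasSum
      have := hf.subtype {j : ℕ | x j s = x i s}
      exact summable_subtype_iff_indicator.1 this
  unfold stickyVel
  exact (key m hs).inv.smul (key (fun j => m j • v j) (sp_summable hm hs hb))

lemma sp_int {m : ℕ → ℝ} {v : ℕ → EuclideanSpace ℝ (Fin 2)} {C : ℝ}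
    (hm : ∀ i, 0 < m i) (hs : Summable m) (hb : ∀ j, ‖v j‖ ≤ C)
    (x : ℕ → ℝ → EuclideanSpace ℝ (Fin 2)) (hx : ∀ i, Continuous (x i)) (i : ℕ) (a b : ℝ) :
    IntervalIntegrable (stickyVel m v x i) volume a b := by
  refine (intervalIntegrable_const (c := C)).mono_fun
    (sp_meas hm hs hb x hx i).aestronglyMeasurable ?_
  refine Filter.Eventually.of_forall fun s => ?_
  have hC : 0 ≤ C := (norm_nonneg _).trans (hb 0)
  rw [Real.norm_of_nonneg hC]
  set w := stickyVel m v x i s with hw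
  have h1 := sp_ge hm hs hb x i s (-(innerSL ℝ w)) (-(‖w‖ * C)) (fun j _ => by
    have := real_inner_le_norm w (v j)
    have h2 := mul_le_mul_of_nonneg_left (hb j) (norm_nonneg w)
    simp
    linarith)
  rw [← hw] at h1
  simp [real_inner_self_eq_norm_sq] at h1
  by_contra hlt
  push Not at hlt
  nlinarith [norm_nonneg w]

/-- abstract data facts -/
structure SP (T : ℝ) (m : ℕ → ℝ) (u v : ℕ → EuclideanSpace ℝ (Fin 2))
    (x : ℕ → ℝ → EuclideanSpace ℝ (Fin 2)) : Prop where
  hT : 0 < T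
  hm : ∀ i, 0 < m i
  hs : Summable m
  hb : ∀ j, ‖v j‖ ≤ 2
  hc : ∀ i, Continuous (x i)
  hw : ∀ i, ∀ t ∈ Icc (0 : ℝ) T, x i t = u i + ∫ s in (0 : ℝ)..t, stickyVel m v x i s
  st : ∀ i j, ∀ t₀ ∈ Icc (0 : ℝ) T, x i t₀ = x j t₀ → ∀ t ∈ Icc t₀ T, x i t = x j t

namespace SP

variable {T : ℝ} {m : ℕ → ℝ} {u v : ℕ → EuclideanSpace ℝ (Fin 2)}
    {x : ℕ → ℝ → EuclideanSpace ℝ (Fin 2)}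

lemma intL (h : SP T m u v x) (L : EuclideanSpace ℝ (Fin 2) →L[ℝ] ℝ) (i : ℕ) (a b : ℝ) :
    IntervalIntegrable (fun s => L (stickyVel m v x i s)) volume a b := by
  have := sp_int h.hm h.hs h.hb x h.hc i a b
  exact ⟨L.integrable_comp this.1, L.integrable_comp this.2⟩

lemma diff (h : SP T m u v x) (L : EuclideanSpace ℝ (Fin 2) →L[ℝ] ℝ) (i : ℕ) {a b : ℝ}
    (ha : a ∈ Icc 0 T) (hb : b ∈ Icc 0 T) :
    L (x i b) - L (x i a) = ∫ s in a..b, L (stickyVel m v x i s) := by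
  rw [h.hw i a ha, h.hw i b hb, map_add, map_add,
    ← L.intervalIntegral_comp_comm (sp_int h.hm h.hs h.hb x h.hc i 0 a),
    ← L.intervalIntegral_comp_comm (sp_int h.hm h.hs h.hb x h.hc i 0 b),
    ← intervalIntegral.integral_interval_sub_left (h.intL L i 0 b) (h.intL L i 0 a)]
  ring

lemma init (h : SP T m u v x) (i : ℕ) : x i 0 = u i := by
  simpa using h.hw i 0 ⟨le_rfl, h.hT.le⟩

lemma diff_ge (h : SP T m u v x) (L : EuclideanSpace ℝ (Fin 2) →L[ℝ] ℝ) (i : ℕ) {a b : ℝ}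
    (ha : 0 ≤ a) (hab : a ≤ b) (hb : b ≤ T) (c : ℝ)
    (H : ∀ s ∈ Ioo a b, ∀ j, x j s = x i s → c ≤ L (v j)) :
    c * (b - a) ≤ L (x i b) - L (x i a) := by
  rw [h.diff L i ⟨ha, hab.trans hb⟩ ⟨ha.trans hab, hb⟩]
  have : c * (b - a) = ∫ s in a..b, c := by simp [mul_comm]
  rw [this]
  refine intervalIntegral.integral_mono_on_of_le_Ioo hab intervalIntegrable_const
    (h.intL L i a b) ?_
  intro s hs'
  exact sp_ge h.hm h.hs h.hb x i s L c (H s hs')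

lemma diff_gt (h : SP T m u v x) (L : EuclideanSpace ℝ (Fin 2) →L[ℝ] ℝ) (i : ℕ) {a b : ℝ}
    (ha : 0 ≤ a) (hab : a < b) (hb : b ≤ T) (c : ℝ)
    (H : ∀ s ∈ Ioo a b, ∀ j, x j s = x i s → c ≤ L (v j)) (k : ℕ)
    (hk : ∀ s ∈ Ioo a b, x k s = x i s) (hk' : c < L (v k)) :
    c * (b - a) < L (x i b) - L (x i a) := by
  rw [h.diff L i ⟨ha, hab.le.trans hb⟩ ⟨ha.trans hab.le, hb⟩]
  have : c * (b - a) = ∫ s in a..b, c := by simp [mul_comm]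
  rw [this, ← sub_pos, ← intervalIntegral.integral_sub (h.intL L i a b) intervalIntegrable_const]
  refine intervalIntegral.intervalIntegral_pos_of_pos_on
    ((h.intL L i a b).sub intervalIntegrable_const) ?_ hab
  intro s hs'
  exact sub_pos.2 (sp_gt h.hm h.hs h.hb x i s L c (H s hs') k (hk s hs') hk')

lemma diff_eq (h : SP T m u v x) (L : EuclideanSpace ℝ (Fin 2) →L[ℝ] ℝ) (i : ℕ) {b : ℝ}
    (hab : 0 ≤ b) (hb : b ≤ T) (c : ℝ)
    (H : ∀ s ∈ Ioo 0 b, ∀ j, x j s = x i s → L (v j) = c) :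
    L (x i b) = L (u i) + c * b := by
  have h1 := h.diff_ge L i le_rfl hab hb c (fun s hs j hj => (H s hs j hj).ge)
  have h2 := h.diff_ge (-L) i le_rfl hab hb (-c) (fun s hs j hj => by simp [H s hs j hj])
  simp [h.init] at h1 h2
  linarith

end SP

/-- initial positions -/
noncomputable def spU (i : ℕ) : EuclideanSpace ℝ (Fin 2) := !₂[-(1 / (i : ℝ)), (1 / (i : ℝ)) ^ 2]

/-- initial velocities -/
noncomputable def spV (i : ℕ) : EuclideanSpace ℝ (Fin 2) :=
  if i = 0 then 0 else !₂[1, -(1 / (i : ℝ))]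

/-- coordinate -/
noncomputable def spP (k : Fin 2) : EuclideanSpace ℝ (Fin 2) →L[ℝ] ℝ := EuclideanSpace.proj k

lemma spP_apply (k : Fin 2) (w : EuclideanSpace ℝ (Fin 2)) : spP k w = w k := rfl

lemma spU0 (i : ℕ) : spP 0 (spU i) = -(1 / (i : ℝ)) := by simp [spP_apply, spU]
lemma spU1 (i : ℕ) : spP 1 (spU i) = (1 / (i : ℝ)) ^ 2 := by simp [spP_apply, spU]
lemma spVz : spV 0 = 0 := by simp [spV]
lemma spV0 {i : ℕ} (hi : i ≠ 0) : spP 0 (spV i) = 1 := by simp [spP_apply, spV, hi]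
lemma spV1 {i : ℕ} (hi : i ≠ 0) : spP 1 (spV i) = -(1 / (i : ℝ)) := by simp [spP_apply, spV, hi]

lemma spV_norm (i : ℕ) : ‖spV i‖ ≤ 2 := by
  unfold spV
  split_ifs with hi
  · simp
  · rw [EuclideanSpace.norm_eq]
    have : (1:ℝ) ≤ i := by exact_mod_cast Nat.one_le_iff_ne_zero.2 hi
    have h1 : (1:ℝ) / i ≤ 1 := by rw [div_le_one (by linarith)]; exact this
    have h0 : (0:ℝ) ≤ 1 / i := by positivity
    rw [Real.sqrt_le_left (by norm_num)]
    simp only [Fin.sum_univ_two, Real.norm_eq_abs, sq_abs]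
    simp only [PiLp.toLp_apply, Matrix.cons_val_zero, Matrix.cons_val_one]
    nlinarith

namespace SP

variable {T : ℝ} {m : ℕ → ℝ} {x : ℕ → ℝ → EuclideanSpace ℝ (Fin 2)}

lemma unhit0 (h : SP T m spU spV x) {i : ℕ} {τ : ℝ} (h0 : 0 ≤ τ) (hT' : τ ≤ T)
    (hu : ∀ s ∈ Ico 0 τ, x i s ≠ x 0 s) : spP 0 (x i τ) = τ - 1 / (i : ℝ) := by
  rw [h.diff_eq (spP 0) i h0 hT' 1, spU0]
  · ring
  · intro s hs j hj
    apply spV0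
    rintro rfl
    exact hu s ⟨hs.1.le, hs.2⟩ hj.symm

lemma unhit1 (h : SP T m spU spV x) {i : ℕ} (hi : i ≠ 0) {τ : ℝ} (h0 : 0 ≤ τ) (hT' : τ ≤ T)
    (hu : ∀ s ∈ Ico 0 τ, x i s ≠ x 0 s) :
    spP 1 (x i τ) = -(1 / (i : ℝ)) * (τ - 1 / (i : ℝ)) := by
  rw [h.diff_eq (spP 1) i h0 hT' (-(1 / (i : ℝ))), spU1]
  · ring
  · intro s hs j hj
    have hsI : s ∈ Ico 0 τ := ⟨hs.1.le, hs.2⟩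
    have ei := h.unhit0 (i := i) hs.1.le (hs.2.le.trans hT')
      (fun r hr => hu r ⟨hr.1, hr.2.trans hs.2⟩)
    have ej := h.unhit0 (i := j) hs.1.le (hs.2.le.trans hT') (fun r hr hh => by
      have := h.st j 0 r ⟨hr.1, hr.2.le.trans (hs.2.le.trans hT')⟩ hh s
        ⟨hr.2.le, hs.2.le.trans hT'⟩
      exact hu s hsI (hj ▸ this))
    have hj0 : j ≠ 0 := by
      rintro rfl
      exact hu s hsI hj.symm
    rw [hj] at ej
    rw [spV1 hj0]
    linarith

lemma first (h : SP T m spU spV x) {n : ℕ} (hn : n ≠ 0) {t : ℝ} (ht : t ∈ Icc 0 T)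
    (hh : x n t = x 0 t) : ∃ τ ∈ Icc 0 t, (∀ s ∈ Icc τ T, x n s = x 0 s) ∧
      spP 0 (x 0 τ) = τ - 1 / (n : ℝ) ∧
      spP 1 (x 0 τ) = -(1 / (n : ℝ)) * (τ - 1 / (n : ℝ)) := by
  have hcl : IsCompact (Icc 0 t ∩ {s | x n s = x 0 s}) :=
    isCompact_Icc.inter_right (isClosed_eq (h.hc n) (h.hc 0))
  obtain ⟨τ, ⟨hτ, hτ'⟩, hmin⟩ := hcl.exists_isLeast ⟨t, ⟨ht.1, le_rfl⟩, hh⟩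
  have hu : ∀ s ∈ Ico 0 τ, x n s ≠ x 0 s := fun s hs he =>
    absurd (hmin ⟨⟨hs.1, hs.2.le.trans hτ.2⟩, he⟩) (not_le.2 hs.2)
  have hτ'' : x n τ = x 0 τ := hτ'
  refine ⟨τ, hτ, h.st n 0 τ ⟨hτ.1, hτ.2.trans ht.2⟩ hτ'', ?_, ?_⟩
  · rw [← hτ'']; exact h.unhit0 hτ.1 (hτ.2.trans ht.2) hu
  · rw [← hτ'']; exact h.unhit1 hn hτ.1 (hτ.2.trans ht.2) hu

lemma strict (h : SP T m spU spV x) {a b : ℝ} (ha : 0 ≤ a) (hab : a < b) (hb : b ≤ T) :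
    a - spP 0 (x 0 a) < b - spP 0 (x 0 b) := by
  have := h.diff_gt (-(spP 0)) 0 ha hab hb (-1) (fun s _ j _ => by
    by_cases hj : j = 0
    · subst hj; simp [spVz]
    · simp [spV0 hj]) 0 (fun _ _ => rfl) (by simp [spVz])
  simp at this
  linarith

/-- if `j` is at particle 0 at a time before the first hit of `n`, then `j > n` (in time order). -/
lemma order (h : SP T m spU spV x) {n j : ℕ} (hj : j ≠ 0) {s τ : ℝ}
    (hs : s ∈ Ico 0 τ) (hτ : τ ≤ T) (he : spP 0 (x 0 τ) = τ - 1 / (n : ℝ))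
    (hh : x j s = x 0 s) : 1 / (j : ℝ) < 1 / (n : ℝ) := by
  obtain ⟨σ, hσ, -, e, -⟩ := h.first hj ⟨hs.1, hs.2.le.trans hτ⟩ hh
  have := h.strict hσ.1 (hσ.2.trans_lt hs.2) hτ
  linarith

lemma lem4 (h : SP T m spU spV x) {n k : ℕ} (hn : n ≠ 0) (hk : k ≠ 0) {τ s : ℝ}
    (hs : s ∈ Ico 0 τ) (hτ : τ ≤ T) (e0 : spP 0 (x 0 τ) = τ - 1 / (n : ℝ))
    (e1 : spP 1 (x 0 τ) = -(1 / (n : ℝ)) * (τ - 1 / (n : ℝ)))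
    (hh : x k s = x 0 s) : False := by
  have hpos : ∀ r ∈ Ico 0 τ, ∀ j, x j r = x 0 r →
      0 ≤ (spP 1 + (1 / (n : ℝ)) • spP 0) (spV j) := by
    intro r hr j hj
    by_cases hj0 : j = 0
    · subst hj0; simp [spVz]
    · have := h.order hj0 hr hτ e0 hj
      simp only [ContinuousLinearMap.add_apply, ContinuousLinearMap.smul_apply, spV1 hj0,
        spV0 hj0, smul_eq_mul]
      linarith
  have h1 := h.diff_ge (spP 1 + (1 / (n : ℝ)) • spP 0) 0 le_rfl hs.1 (hs.2.le.trans hτ) 0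
    (fun r hr => hpos r ⟨hr.1.le, hr.2.trans hs.2⟩)
  have h2 := h.diff_gt (spP 1 + (1 / (n : ℝ)) • spP 0) 0 hs.1 hs.2 hτ 0
    (fun r hr => hpos r ⟨hs.1.trans hr.1.le, hr.2⟩) k
    (fun r hr => h.st k 0 s ⟨hs.1, hs.2.le.trans hτ⟩ hh r ⟨hr.1.le, hr.2.le.trans hτ⟩)
    (by
      have := h.order hk hs hτ e0 hh
      simp only [ContinuousLinearMap.add_apply, ContinuousLinearMap.smul_apply, spV1 hk,
        spV0 hk, smul_eq_mul]
      linarith)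
  simp only [ContinuousLinearMap.add_apply, ContinuousLinearMap.smul_apply, smul_eq_mul,
    h.init, spU0, spU1, e0, e1] at h1 h2
  simp at h1 h2
  linarith

/-- If nothing hits particle 0 before time `τ`, it stays at the origin, and so every particle
with arrival time at most `τ`, hits. -/
lemma rest (h : SP T m spU spV x) {τ : ℝ} (hτ : τ ≤ T) (h0 : 0 ≤ τ)
    (hu : ∀ s ∈ Ico 0 τ, ∀ j, j ≠ 0 → x j s ≠ x 0 s) :
    spP 0 (x 0 τ) = 0 ∧ spP 1 (x 0 τ) = 0 := by
  constructor
  all_goals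
    rw [h.diff_eq _ 0 h0 hτ 0 ?_]
    · simp [spU0, spU1]
    · intro s hs j hj
      by_cases hj0 : j = 0
      · subst hj0; simp [spVz]
      · exact absurd hj (hu s ⟨hs.1.le, hs.2⟩ j hj0)

lemma meet (h : SP T m spU spV x) {n : ℕ} (hn : n ≠ 0) (hT' : 1 / (n : ℝ) ≤ T)
    (hu : ∀ s ∈ Ico 0 (1 / (n : ℝ)), ∀ j, j ≠ 0 → x j s ≠ x 0 s) :
    x n (1 / (n : ℝ)) = x 0 (1 / (n : ℝ)) := by
  have hp : (0:ℝ) ≤ 1 / (n : ℝ) := by positivity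
  obtain ⟨a, b⟩ := h.rest hT' hp hu
  have a' := h.unhit0 hp hT' (fun s hs => hu s hs n hn)
  have b' := h.unhit1 hn hp hT' (fun s hs => hu s hs n hn)
  simp only [spP_apply] at *
  ext k
  fin_cases k
  · simp at *; rw [a, a']
  · simp at *; rw [b, b']

lemma nohit (h : SP T m spU spV x) {n : ℕ} (hn : n ≠ 0) {t : ℝ} (ht : t ∈ Icc 0 T) :
    x n t ≠ x 0 t := by
  intro hh
  obtain ⟨τ, hτ, -, e0, e1⟩ := h.first hn ht hh
  have hτT := hτ.2.trans ht.2
  have hu : ∀ s ∈ Ico 0 τ, ∀ j, j ≠ 0 → x j s ≠ x 0 s :=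
    fun s hs j hj hjs => h.lem4 hn hj hs hτT e0 e1 hjs
  have hr := (h.rest hτT hτ.1 hu).1
  have hlt : 1 / ((n + 1 : ℕ) : ℝ) < τ := by
    have h1 : τ = 1 / (n : ℝ) := by linarith
    rw [h1]
    have : (0:ℝ) < n := by exact_mod_cast Nat.pos_of_ne_zero hn
    apply one_div_lt_one_div_of_lt this
    push_cast; linarith
  exact hu _ ⟨by positivity, hlt⟩ (n + 1) (Nat.succ_ne_zero n)
    (h.meet (Nat.succ_ne_zero n) (hlt.le.trans hτT)
      (fun s hs => hu s ⟨hs.1, hs.2.trans hlt⟩))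

lemma contra (h : SP T m spU spV x) : False := by
  obtain ⟨n, hn⟩ := exists_nat_one_div_lt h.hT
  have hn' : 1 / ((n + 1 : ℕ) : ℝ) < T := by exact_mod_cast hn
  have hp : (0:ℝ) ≤ 1 / ((n + 1 : ℕ) : ℝ) := by positivity
  exact h.nohit (Nat.succ_ne_zero n) ⟨hp, hn'.le⟩
    (h.meet (Nat.succ_ne_zero n) hn'.le
      (fun s hs j hj => h.nohit hj ⟨hs.1, hs.2.le.trans hn'.le⟩))

end SP

/-- Example 4: non-existence of sticky solutions.  There are countably many particles in
the plane, with positive masses, finite total mass and finite total energy, such that the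
corresponding Cauchy problem for the sticky particle system admits no sticky solution on
`[0, T]`, for any `T > 0`. -/
theorem sticky_solution_nonexistence :
    ∃ (m : ℕ → ℝ) (xInit vInit : ℕ → EuclideanSpace ℝ (Fin 2)),
      (∀ i, 0 < m i) ∧ Summable m ∧ Summable (fun i => m i * ‖vInit i‖ ^ 2) ∧
      ∀ T : ℝ, 0 < T →
        ¬ ∃ x : ℕ → ℝ → EuclideanSpace ℝ (Fin 2),
            IsStickySolutionOn T m xInit vInit x := by
  have hsum : Summable (fun i : ℕ => ((1:ℝ) / 2) ^ i) := summable_geometric_two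
  refine ⟨fun i => (1 / 2) ^ i, spU, spV, fun i => by positivity, hsum, ?_, ?_⟩
  · refine Summable.of_nonneg_of_le (fun i => by positivity) (fun i => ?_) (hsum.mul_right 4)
    have := spV_norm i
    have h0 := norm_nonneg (spV i)
    exact mul_le_mul_of_nonneg_left (by nlinarith) (by positivity)
  · rintro T hT ⟨x, ⟨hc, -, hw⟩, hst⟩
    have hcl : ∀ t ∈ Icc (0:ℝ) T, max 0 (min t T) = t := fun t ht => by
      rw [min_eq_left ht.2, max_eq_right ht.1]
    refine SP.contra (T := T) (m := fun i => (1 / 2) ^ i) (x := fun i t => x i (max 0 (min t T)))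
      ⟨hT, fun i => by positivity, hsum, spV_norm, ?_, ?_, ?_⟩
    · intro i
      refine (hc i).comp_continuous (by fun_prop) (fun t => ⟨le_max_left _ _, ?_⟩)
      exact max_le hT.le (min_le_right _ _)
    · intro i t ht
      simp only [hcl t ht]
      rw [hw i t ht]
      congr 1
      apply intervalIntegral.integral_congr
      intro s hs
      rw [uIcc_of_le ht.1] at hs
      have hs' := hcl s ⟨hs.1, hs.2.trans ht.2⟩
      change stickyVel _ _ x i s = stickyVel _ _ x i (max 0 (min s T))
      rw [hs']
    · intro i j t₀ ht₀ he t ht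
      simp only [hcl t₀ ht₀] at he
      simp only [hcl t ⟨ht₀.1.trans ht.1, ht.2⟩]
      exact hst i j t₀ ht₀ he t ht
end
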